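/- arXiv:2202.08828 — 6 statements merged into one kernel-verified Lean document; each statement's English description precedes it below -/
import Mathlib

section
/- For every finite simple graph G and all integers 1 ≤ ℓ ≤ k, there exists an injective F-linear map Φ : V_{ℓ-1} ⊗ V_{k+1} → V_{ℓ} ⊗ V_{k} that is Aut(G)-equivariant, i.e., Φ(σ·v) = σ·Φ(v) for every graph automorphism σ of G and every v ∈ V_{ℓ-1} ⊗ V_{k+1}. In other words, the graded Aut(G)-representation V_G^• = ⊕_k V_k is strongly Aut(G)-equivariantly log-concave. -/
/-- A matching on a simple graph `G`: a finite set of edges of `G` that are pairwise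
disjoint (no two distinct edges share a vertex). -/
def IsMatching {V : Type*} (G : SimpleGraph V) (M : Finset (Sym2 V)) : Prop :=
  (M : Set (Sym2 V)) ⊆ G.edgeSet ∧
    ∀ e ∈ M, ∀ f ∈ M, e ≠ f → ∀ v, v ∈ e → v ∉ f

/-- The matchings of size `k` on `G`. -/
def Matchings {V : Type*} (G : SimpleGraph V) (k : ℕ) : Type _ :=
  {M : Finset (Sym2 V) // IsMatching G M ∧ M.card = k}

lemma isMatching_map {V : Type*} [DecidableEq V] {G : SimpleGraph V} (σ : G ≃g G)
    {M : Finset (Sym2 V)} (h : IsMatching G M) :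
    IsMatching G (M.image (Sym2.map σ)) := by
  constructor
  · intro e he
    simp only [Finset.coe_image, Set.mem_image, Finset.mem_coe] at he
    obtain ⟨a, ha, rfl⟩ := he
    exact σ.toHom.map_mem_edgeSet (h.1 ha)
  · intro e he f hf hef v hv hv'
    simp only [Finset.mem_image] at he hf
    obtain ⟨a, ha, rfl⟩ := he
    obtain ⟨b, hb, rfl⟩ := hf
    have hab : a ≠ b := fun hE => hef (by rw [hE])
    obtain ⟨w, hw, hwv⟩ := (Sym2.mem_map).1 hv
    obtain ⟨u, hu, huv⟩ := (Sym2.mem_map).1 hv'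
    have : u = w := σ.injective (by rw [hwv, huv])
    exact h.2 a ha b hb hab w hw (this ▸ hu)

/-- The action of a graph automorphism on `k`-matchings. -/
def matchingsMap {V : Type*} [DecidableEq V] {G : SimpleGraph V} (σ : G ≃g G) {k : ℕ} :
    Matchings G k → Matchings G k :=
  fun M => ⟨M.val.image (Sym2.map σ),
    isMatching_map σ M.prop.1, by
      rw [Finset.card_image_of_injective _ (Sym2.map.injective σ.injective)]
      exact M.prop.2⟩

/-- `V_k`, the `F`-vector space with basis the `k`-matchings of `G`, realized as
finitely supported functions. -/
abbrev MatchRep (F : Type*) [Field F] {V : Type*} (G : SimpleGraph V) (k : ℕ) : Type _ :=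
  Matchings G k →₀ F

/-- The linear action of an automorphism `σ` on `V_k`, permuting basis vectors. -/
noncomputable def actV (F : Type*) [Field F] {V : Type*} [DecidableEq V] {G : SimpleGraph V}
    (σ : G ≃g G) (k : ℕ) : MatchRep F G k →ₗ[F] MatchRep F G k :=
  Finsupp.lmapDomain F F (matchingsMap σ)

namespace SimpleGraph

variable {V : Type*} [Fintype V]

open Classical in
/-- The vertex sets of the connected components of `H`. -/
noncomputable def componentSets (H : SimpleGraph V) : Finset (Finset V) :=
  Finset.univ.filter fun S => ∃ v, ∀ w, w ∈ S ↔ H.Reachable v w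

lemma mem_componentSets {H : SimpleGraph V} {S : Finset V} :
    S ∈ H.componentSets ↔ ∃ v, ∀ w, w ∈ S ↔ H.Reachable v w := by
  simp [componentSets]

lemma eq_of_mem_componentSets {H : SimpleGraph V} {S T : Finset V} (hS : S ∈ H.componentSets)
    (hT : T ∈ H.componentSets) {v : V} (hvS : v ∈ S) (hvT : v ∈ T) : S = T := by
  obtain ⟨a, ha⟩ := mem_componentSets.1 hS
  obtain ⟨b, hb⟩ := mem_componentSets.1 hT
  have hab := ((ha v).1 hvS).trans ((hb v).1 hvT).symm
  ext w
  rw [ha, hb]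
  exact ⟨hab.symm.trans, hab.trans⟩

lemma mem_of_adj_of_mem_componentSets {H : SimpleGraph V} {S : Finset V}
    (hS : S ∈ H.componentSets) {v w : V} (hv : v ∈ S) (hvw : H.Adj v w) : w ∈ S := by
  obtain ⟨a, ha⟩ := mem_componentSets.1 hS
  exact (ha w).2 (((ha v).1 hv).trans hvw.reachable)

lemma exists_mem_componentSets (H : SimpleGraph V) (v : V) : ∃ S ∈ H.componentSets, v ∈ S := by
  classical
  refine ⟨Finset.univ.filter (H.Reachable v), mem_componentSets.2 ⟨v, by simp⟩, by simp⟩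

lemma connected_induce_of_mem_componentSets {H : SimpleGraph V} {S : Finset V}
    (hS : S ∈ H.componentSets) : (H.induce (S : Set V)).Connected := by
  obtain ⟨v, hv⟩ := mem_componentSets.1 hS
  have : (S : Set V) = (H.connectedComponentMk v).supp := by
    ext w
    simp [hv, ConnectedComponent.mem_supp_iff, ConnectedComponent.eq, reachable_comm]
  rw [this]
  exact (H.connectedComponentMk v).connected_toSimpleGraph

lemma map_mem_componentSets_iff {H H' : SimpleGraph V} (φ : H ≃g H') {S : Finset V} :
    S.map φ.toEquiv.toEmbedding ∈ H'.componentSets ↔ S ∈ H.componentSets := by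
  simp only [mem_componentSets]
  refine (φ.toEquiv.exists_congr fun v => φ.toEquiv.forall_congr fun w => ?_).symm
  have hmem : φ.toEquiv w ∈ S.map φ.toEquiv.toEmbedding ↔ w ∈ S := S.mem_map' _
  rw [hmem]
  exact iff_congr Iff.rfl Iso.reachable_iff.symm

end SimpleGraph

namespace MatchingPair

variable {V : Type*}

lemma sym2_map_mem_sym2_map_iff (φ : V ≃ V) {S : Finset V} {e : Sym2 V} :
    Sym2.map φ e ∈ (S.map φ.toEmbedding).sym2 ↔ e ∈ S.sym2 := by
  induction e with
  | h a b => simp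

section Embedding

variable (F : Type*) [Field F] (G : SimpleGraph V) (i j : ℕ)

/-- The pair of edge sets underlying a pair of matchings. -/
def toPair (p : Matchings G i × Matchings G j) : Finset (Sym2 V) × Finset (Sym2 V) :=
  (p.1.val, p.2.val)

/-- The embedding of `V_i ⊗ V_j` into the space spanned by all pairs of edge sets. -/
noncomputable def embed : TensorProduct F (MatchRep F G i) (MatchRep F G j) →ₗ[F]
    (Finset (Sym2 V) × Finset (Sym2 V) →₀ F) :=
  Finsupp.lmapDomain F F (toPair G i j) ∘ₗ
    (finsuppTensorFinsupp' F (Matchings G i) (Matchings G j)).toLinearMap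

lemma embed_single_tmul_single (M : Matchings G i) (N : Matchings G j) :
    embed F G i j (TensorProduct.tmul F (Finsupp.single M 1) (Finsupp.single N 1)) =
      Finsupp.single (M.val, N.val) 1 := by
  simp [embed, toPair]

lemma embed_injective : Function.Injective (embed F G i j) := by
  refine (Finsupp.mapDomain_injective ?_).comp (LinearEquiv.injective _)
  intro p q h
  exact Prod.ext (Subtype.ext (congrArg Prod.fst h)) (Subtype.ext (congrArg Prod.snd h))

variable {F G i j} in
lemma tensor_hom_ext {W : Type*} [AddCommGroup W] [Module F W]
    {f g : TensorProduct F (MatchRep F G i) (MatchRep F G j) →ₗ[F] W}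
    (h : ∀ M N, f (TensorProduct.tmul F (Finsupp.single M 1) (Finsupp.single N 1)) =
      g (TensorProduct.tmul F (Finsupp.single M 1) (Finsupp.single N 1))) : f = g := by
  refine TensorProduct.ext (Finsupp.lhom_ext' fun M => LinearMap.ext_ring ?_)
  exact Finsupp.lhom_ext' fun N => LinearMap.ext_ring (h M N)

end Embedding

variable [DecidableEq V]

/-- The graph formed by all edges of a pair of edge sets. -/
def unionGraph (x : Finset (Sym2 V) × Finset (Sym2 V)) : SimpleGraph V :=
  SimpleGraph.fromEdgeSet (x.1 ∪ x.2 : Finset (Sym2 V))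

/-- Exchange the edges contained in `S` between the two entries of a pair of edge sets. -/
def swapOn (S : Finset V) (x : Finset (Sym2 V) × Finset (Sym2 V)) :
    Finset (Sym2 V) × Finset (Sym2 V) :=
  (x.1.filter (· ∉ S.sym2) ∪ x.2.filter (· ∈ S.sym2),
    x.2.filter (· ∉ S.sym2) ∪ x.1.filter (· ∈ S.sym2))

/-- The surplus, among the edges contained in `S`, of the second entry over the first. -/
def excess (x : Finset (Sym2 V) × Finset (Sym2 V)) (S : Finset V) : ℤ :=
  (x.2.filter (· ∈ S.sym2)).card - (x.1.filter (· ∈ S.sym2)).card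

@[simp]
lemma swapOn_swapOn_self (S : Finset V) (x : Finset (Sym2 V) × Finset (Sym2 V)) :
    swapOn S (swapOn S x) = x := by
  refine Prod.ext (Finset.ext fun e => ?_) (Finset.ext fun e => ?_) <;>
  · simp only [swapOn, Finset.mem_union, Finset.mem_filter]
    tauto

lemma swapOn_comm (S T : Finset V) (x : Finset (Sym2 V) × Finset (Sym2 V)) :
    swapOn S (swapOn T x) = swapOn T (swapOn S x) := by
  refine Prod.ext (Finset.ext fun e => ?_) (Finset.ext fun e => ?_) <;>
  · simp only [swapOn, Finset.mem_union, Finset.mem_filter]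
    tauto

@[simp]
lemma unionGraph_swapOn (S : Finset V) (x : Finset (Sym2 V) × Finset (Sym2 V)) :
    unionGraph (swapOn S x) = unionGraph x := by
  have : (swapOn S x).1 ∪ (swapOn S x).2 = x.1 ∪ x.2 := by
    ext e
    simp only [swapOn, Finset.mem_union, Finset.mem_filter]
    tauto
  rw [unionGraph, this, unionGraph]

lemma excess_swapOn_self (S : Finset V) (x : Finset (Sym2 V) × Finset (Sym2 V)) :
    excess (swapOn S x) S = -excess x S := by
  have h : ∀ A B : Finset (Sym2 V),
      (A.filter (· ∉ S.sym2) ∪ B.filter (· ∈ S.sym2)).filter (· ∈ S.sym2) =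
        B.filter (· ∈ S.sym2) := by
    intro A B
    ext e
    simp only [Finset.mem_union, Finset.mem_filter]
    tauto
  simp only [excess, swapOn, h]
  ring

lemma excess_swapOn_of_disjoint {S T : Finset V} (hST : Disjoint S T)
    (x : Finset (Sym2 V) × Finset (Sym2 V)) :
    excess (swapOn S x) T = excess x T := by
  have hdisj : ∀ e : Sym2 V, e ∈ T.sym2 → e ∉ S.sym2 := by
    intro e
    induction e with
    | h a b =>
      simp only [Finset.mk_mem_sym2_iff]
      exact fun h h' => Finset.disjoint_left.1 hST h'.1 h.1
  have h : ∀ A B : Finset (Sym2 V),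
      (A.filter (· ∉ S.sym2) ∪ B.filter (· ∈ S.sym2)).filter (· ∈ T.sym2) =
        A.filter (· ∈ T.sym2) := by
    intro A B
    ext e
    have := hdisj e
    simp only [Finset.mem_union, Finset.mem_filter]
    tauto
  simp only [excess, swapOn, h]

lemma card_swapOn_fst (S : Finset V) (x : Finset (Sym2 V) × Finset (Sym2 V)) :
    ((swapOn S x).1.card : ℤ) = x.1.card + excess x S := by
  rw [swapOn, Finset.card_union_of_disjoint, ← Finset.card_filter_add_card_filter_not
    (s := x.1) (· ∈ S.sym2), excess]
  · push_cast
    ring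
  · exact Finset.disjoint_left.2 fun e he he' =>
      (Finset.mem_filter.1 he).2 (Finset.mem_filter.1 he').2

lemma card_swapOn_snd (S : Finset V) (x : Finset (Sym2 V) × Finset (Sym2 V)) :
    ((swapOn S x).2.card : ℤ) = x.2.card - excess x S := by
  rw [swapOn, Finset.card_union_of_disjoint, ← Finset.card_filter_add_card_filter_not
    (s := x.2) (· ∈ S.sym2), excess]
  · push_cast
    ring
  · exact Finset.disjoint_left.2 fun e he he' =>
      (Finset.mem_filter.1 he).2 (Finset.mem_filter.1 he').2

lemma two_mul_card_filter_sym2_le {G : SimpleGraph V} {M : Finset (Sym2 V)} (h : IsMatching G M)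
    (S : Finset V) : 2 * (M.filter (· ∈ S.sym2)).card ≤ S.card := by
  have hcard : ∀ e ∈ M.filter (· ∈ S.sym2), e.toFinset.card = 2 := fun e he =>
    Sym2.card_toFinset_of_not_isDiag e
      (G.not_isDiag_of_mem_edgeSet (h.1 (Finset.mem_filter.1 he).1))
  rw [mul_comm, ← Finset.sum_const_nat hcard, ← Finset.card_biUnion]
  · refine Finset.card_le_card fun v hv => ?_
    obtain ⟨e, he, hve⟩ := Finset.mem_biUnion.1 hv
    exact Finset.mem_sym2_iff.1 (Finset.mem_filter.1 he).2 v (Sym2.mem_toFinset.1 hve)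
  · intro e he f hf hef
    exact Finset.disjoint_left.2 fun v hve hvf =>
      h.2 e (Finset.mem_filter.1 he).1 f (Finset.mem_filter.1 hf).1 hef v
        (Sym2.mem_toFinset.1 hve) (Sym2.mem_toFinset.1 hvf)

/-- The action of a permutation of the vertices on pairs of edge sets. -/
def mapPair (φ : V ≃ V) (x : Finset (Sym2 V) × Finset (Sym2 V)) :
    Finset (Sym2 V) × Finset (Sym2 V) :=
  (x.1.image (Sym2.map φ), x.2.image (Sym2.map φ))

lemma swapOn_mapPair (φ : V ≃ V) (S : Finset V) (x : Finset (Sym2 V) × Finset (Sym2 V)) :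
    swapOn (S.map φ.toEmbedding) (mapPair φ x) = mapPair φ (swapOn S x) := by
  simp only [swapOn, mapPair, Finset.filter_image, Finset.image_union, sym2_map_mem_sym2_map_iff]

lemma excess_mapPair (φ : V ≃ V) (S : Finset V) (x : Finset (Sym2 V) × Finset (Sym2 V)) :
    excess (mapPair φ x) (S.map φ.toEmbedding) = excess x S := by
  simp only [excess, mapPair, Finset.filter_image, sym2_map_mem_sym2_map_iff,
    Finset.card_image_of_injective _ (Sym2.map.injective φ.injective)]

section Components

variable [Fintype V]

/-- The components of a pair of edge sets on which the surplus equals `ε`. -/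
noncomputable def componentsOfExcess (ε : ℤ) (x : Finset (Sym2 V) × Finset (Sym2 V)) :
    Finset (Finset V) :=
  (unionGraph x).componentSets.filter (excess x · = ε)

lemma mem_componentsOfExcess {ε : ℤ} {x : Finset (Sym2 V) × Finset (Sym2 V)} {S : Finset V} :
    S ∈ componentsOfExcess ε x ↔ S ∈ (unionGraph x).componentSets ∧ excess x S = ε := by
  simp [componentsOfExcess]

lemma excess_swapOn_of_ne {x : Finset (Sym2 V) × Finset (Sym2 V)} {S T : Finset V}
    (hS : S ∈ (unionGraph x).componentSets) (hT : T ∈ (unionGraph x).componentSets)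
    (hST : T ≠ S) : excess (swapOn S x) T = excess x T :=
  excess_swapOn_of_disjoint (Finset.disjoint_left.2 fun _ hvS hvT =>
    hST (SimpleGraph.eq_of_mem_componentSets hT hS hvT hvS)) x

lemma componentsOfExcess_swapOn_self {ε : ℤ} (hε : ε ≠ 0)
    {x : Finset (Sym2 V) × Finset (Sym2 V)} {S : Finset V} (hS : S ∈ componentsOfExcess ε x) :
    componentsOfExcess ε (swapOn S x) = (componentsOfExcess ε x).erase S := by
  rw [mem_componentsOfExcess] at hS
  ext T
  rw [Finset.mem_erase, mem_componentsOfExcess, mem_componentsOfExcess, unionGraph_swapOn]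
  by_cases hTS : T = S
  · subst hTS
    rw [excess_swapOn_self]
    constructor
    · rintro ⟨-, h⟩
      omega
    · tauto
  · constructor
    · rintro ⟨hT, h⟩
      exact ⟨hTS, hT, excess_swapOn_of_ne hS.1 hT hTS ▸ h⟩
    · rintro ⟨-, hT, h⟩
      exact ⟨hT, (excess_swapOn_of_ne hS.1 hT hTS).trans h⟩

lemma componentsOfExcess_neg_swapOn {ε : ℤ}
    {x : Finset (Sym2 V) × Finset (Sym2 V)} {S : Finset V} (hS : S ∈ componentsOfExcess ε x) :
    componentsOfExcess (-ε) (swapOn S x) = insert S (componentsOfExcess (-ε) x) := by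
  rw [mem_componentsOfExcess] at hS
  ext T
  rw [Finset.mem_insert, mem_componentsOfExcess, mem_componentsOfExcess, unionGraph_swapOn]
  by_cases hTS : T = S
  · subst hTS
    rw [excess_swapOn_self, hS.2]
    exact ⟨fun _ => Or.inl rfl, fun _ => ⟨hS.1, rfl⟩⟩
  · constructor
    · rintro ⟨hT, h⟩
      exact Or.inr ⟨hT, excess_swapOn_of_ne hS.1 hT hTS ▸ h⟩
    · rintro (h | ⟨hT, h⟩)
      · exact absurd h hTS
      · exact ⟨hT, (excess_swapOn_of_ne hS.1 hT hTS).trans h⟩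

lemma not_mem_componentsOfExcess_neg {ε : ℤ} (hε : ε ≠ 0)
    {x : Finset (Sym2 V) × Finset (Sym2 V)} {S : Finset V} (hS : S ∈ componentsOfExcess ε x) :
    S ∉ componentsOfExcess (-ε) x := by
  rw [mem_componentsOfExcess] at hS ⊢
  rintro ⟨-, h⟩
  omega

lemma mem_sym2_of_mem_componentSets {G : SimpleGraph V} {x : Finset (Sym2 V) × Finset (Sym2 V)}
    {S : Finset V} (hS : S ∈ (unionGraph x).componentSets) {e : Sym2 V} (hG : e ∈ G.edgeSet)
    (he : e ∈ x.1 ∪ x.2) {v : V} (hve : v ∈ e) (hvS : v ∈ S) : e ∈ S.sym2 := by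
  obtain ⟨w, rfl⟩ := hve
  rw [Finset.mk_mem_sym2_iff]
  refine ⟨hvS, SimpleGraph.mem_of_adj_of_mem_componentSets hS hvS ?_⟩
  rw [unionGraph, SimpleGraph.fromEdgeSet_adj]
  exact ⟨he, (G.mem_edgeSet.1 hG).ne⟩

lemma isMatching_swapOn_fst {G : SimpleGraph V} {x : Finset (Sym2 V) × Finset (Sym2 V)}
    (h₁ : IsMatching G x.1) (h₂ : IsMatching G x.2) {S : Finset V}
    (hS : S ∈ (unionGraph x).componentSets) : IsMatching G (swapOn S x).1 := by
  have key : ∀ e ∈ x.1, e ∉ S.sym2 → ∀ f ∈ x.2, f ∈ S.sym2 → ∀ v, v ∈ e → v ∉ f :=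
    fun e he heS f hf hfS v hve hvf => heS <| mem_sym2_of_mem_componentSets hS (h₁.1 he)
      (Finset.mem_union_left _ he) hve (Finset.mem_sym2_iff.1 hfS v hvf)
  constructor
  · intro e he
    rw [swapOn, Finset.mem_coe, Finset.mem_union, Finset.mem_filter, Finset.mem_filter] at he
    exact he.elim (fun h => h₁.1 h.1) fun h => h₂.1 h.1
  · intro e he f hf hef v hve hvf
    rw [swapOn, Finset.mem_union, Finset.mem_filter, Finset.mem_filter] at he hf
    rcases he with ⟨he, heS⟩ | ⟨he, heS⟩ <;> rcases hf with ⟨hf, hfS⟩ | ⟨hf, hfS⟩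
    · exact h₁.2 e he f hf hef v hve hvf
    · exact key e he heS f hf hfS v hve hvf
    · exact key f hf hfS e he heS v hvf hve
    · exact h₂.2 e he f hf hef v hve hvf

lemma isMatching_swapOn_snd {G : SimpleGraph V} {x : Finset (Sym2 V) × Finset (Sym2 V)}
    (h₁ : IsMatching G x.1) (h₂ : IsMatching G x.2) {S : Finset V}
    (hS : S ∈ (unionGraph x).componentSets) : IsMatching G (swapOn S x).2 := by
  have hS' : S ∈ (unionGraph x.swap).componentSets := by
    rwa [unionGraph, Prod.fst_swap, Prod.snd_swap, Finset.union_comm]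
  exact isMatching_swapOn_fst (x := x.swap) h₂ h₁ hS'

lemma card_eq_sum_componentSets {G : SimpleGraph V} {x : Finset (Sym2 V) × Finset (Sym2 V)}
    {A : Finset (Sym2 V)} (hA : A ⊆ x.1 ∪ x.2) (hG : (A : Set (Sym2 V)) ⊆ G.edgeSet) :
    A.card = ∑ S ∈ (unionGraph x).componentSets, (A.filter (· ∈ S.sym2)).card := by
  rw [← Finset.card_biUnion]
  · congr 1
    ext e
    simp only [Finset.mem_biUnion, Finset.mem_filter]
    refine ⟨fun he => ?_, fun ⟨_, _, he, _⟩ => he⟩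
    obtain ⟨S, hS, hvS⟩ := (unionGraph x).exists_mem_componentSets e.out.1
    exact ⟨S, hS, he, mem_sym2_of_mem_componentSets hS (hG he) (hA he) e.out_fst_mem hvS⟩
  · intro S hS T hT hST
    refine Finset.disjoint_left.2 fun e he he' => hST ?_
    exact SimpleGraph.eq_of_mem_componentSets hS hT
      (Finset.mem_sym2_iff.1 (Finset.mem_filter.1 he).2 _ e.out_fst_mem)
      (Finset.mem_sym2_iff.1 (Finset.mem_filter.1 he').2 _ e.out_fst_mem)

lemma card_le_card_filter_sym2_add_one {x : Finset (Sym2 V) × Finset (Sym2 V)} {S : Finset V}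
    (hS : S ∈ (unionGraph x).componentSets) :
    S.card ≤ (x.1.filter (· ∈ S.sym2)).card + (x.2.filter (· ∈ S.sym2)).card + 1 := by
  have hconn := SimpleGraph.connected_induce_of_mem_componentSets hS
  have hle := hconn.card_vert_le_card_edgeSet_add_one
  have hedge : Nat.card ((unionGraph x).induce (S : Set V)).edgeSet ≤
      ((x.1 ∪ x.2).filter (· ∈ S.sym2)).card := by
    rw [← Nat.card_eq_finsetCard]
    refine Nat.card_le_card_of_injective (fun e => ⟨Sym2.map Subtype.val e.1, ?_⟩) ?_
    · obtain ⟨e, he⟩ := e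
      induction e with
      | h a b =>
        rw [SimpleGraph.mem_edgeSet, SimpleGraph.comap_adj, unionGraph,
          SimpleGraph.fromEdgeSet_adj] at he
        exact Finset.mem_filter.2 ⟨he.1, Finset.mk_mem_sym2_iff.2 ⟨a.2, b.2⟩⟩
    · intro e f hef
      exact Subtype.ext (Sym2.map.injective Subtype.val_injective (congrArg Subtype.val hef))
  rw [Finset.filter_union] at hedge
  have hunion := Finset.card_union_le (x.1.filter (· ∈ S.sym2)) (x.2.filter (· ∈ S.sym2))
  have hcard : Nat.card (S : Set V) = S.card := Nat.card_eq_finsetCard S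
  omega

lemma excess_mem {G : SimpleGraph V} {x : Finset (Sym2 V) × Finset (Sym2 V)}
    (h₁ : IsMatching G x.1) (h₂ : IsMatching G x.2) {S : Finset V}
    (hS : S ∈ (unionGraph x).componentSets) :
    excess x S = 1 ∨ excess x S = 0 ∨ excess x S = -1 := by
  have := two_mul_card_filter_sym2_le h₁ S
  have := two_mul_card_filter_sym2_le h₂ S
  have := card_le_card_filter_sym2_add_one hS
  rw [excess]
  omega

/-- The number of components on which the first entry dominates minus the number of those on which
the second one does. -/
noncomputable def weight (x : Finset (Sym2 V) × Finset (Sym2 V)) : ℤ :=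
  (componentsOfExcess (-1) x).card - (componentsOfExcess 1 x).card

lemma weight_eq_card_sub_card {G : SimpleGraph V} {x : Finset (Sym2 V) × Finset (Sym2 V)}
    (h₁ : IsMatching G x.1) (h₂ : IsMatching G x.2) :
    weight x = x.1.card - x.2.card := by
  rw [card_eq_sum_componentSets Finset.subset_union_left h₁.1,
    card_eq_sum_componentSets Finset.subset_union_right h₂.1, weight, componentsOfExcess,
    componentsOfExcess, Finset.card_filter, Finset.card_filter]
  push_cast
  rw [← Finset.sum_sub_distrib, ← Finset.sum_sub_distrib]
  refine Finset.sum_congr rfl fun S hS => ?_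
  have := excess_mem h₁ h₂ hS
  have hdef : excess x S = (x.2.filter (· ∈ S.sym2)).card - (x.1.filter (· ∈ S.sym2)).card := rfl
  split_ifs <;> omega

lemma weight_swapOn_of_mem_one {x : Finset (Sym2 V) × Finset (Sym2 V)} {S : Finset V}
    (hS : S ∈ componentsOfExcess 1 x) : weight (swapOn S x) = weight x + 2 := by
  have hpos := Finset.card_pos.2 ⟨S, hS⟩
  rw [weight, weight, componentsOfExcess_swapOn_self one_ne_zero hS,
    componentsOfExcess_neg_swapOn hS, Finset.card_erase_of_mem hS,
    Finset.card_insert_of_notMem (not_mem_componentsOfExcess_neg one_ne_zero hS)]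
  omega

lemma weight_swapOn_of_mem_neg_one {x : Finset (Sym2 V) × Finset (Sym2 V)} {S : Finset V}
    (hS : S ∈ componentsOfExcess (-1) x) : weight (swapOn S x) = weight x - 2 := by
  have hpos := Finset.card_pos.2 ⟨S, hS⟩
  have hne : (-1 : ℤ) ≠ 0 := by decide
  have hins := componentsOfExcess_neg_swapOn hS
  have hnot := not_mem_componentsOfExcess_neg hne hS
  rw [neg_neg] at hins hnot
  rw [weight, weight, componentsOfExcess_swapOn_self hne hS, hins, Finset.card_erase_of_mem hS,
    Finset.card_insert_of_notMem hnot]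
  omega

section Operators

variable (F : Type*) [Field F]

/-- The operator sending a pair to the sum of all its swaps along components of excess `ε`. -/
noncomputable def swapOp (ε : ℤ) : Module.End F (Finset (Sym2 V) × Finset (Sym2 V) →₀ F) :=
  Finsupp.linearCombination F fun x =>
    ∑ S ∈ componentsOfExcess ε x, Finsupp.single (swapOn S x) 1

/-- The diagonal operator multiplying each pair by its weight. -/
noncomputable def weightOp : Module.End F (Finset (Sym2 V) × Finset (Sym2 V) →₀ F) :=
  Finsupp.linearCombination F fun x => (weight x : F) • Finsupp.single x 1

lemma swapOp_single (ε : ℤ) (x : Finset (Sym2 V) × Finset (Sym2 V)) :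
    swapOp F ε (Finsupp.single x 1) =
      ∑ S ∈ componentsOfExcess ε x, Finsupp.single (swapOn S x) 1 := by
  simp [swapOp]

lemma weightOp_single (x : Finset (Sym2 V) × Finset (Sym2 V)) :
    weightOp F (Finsupp.single x 1) = (weight x : F) • Finsupp.single x 1 := by
  rw [weightOp, Finsupp.linearCombination_single, one_smul]

lemma swapOp_neg_swapOp_single {ε : ℤ} (hε : ε ≠ 0) (x : Finset (Sym2 V) × Finset (Sym2 V)) :
    swapOp F (-ε) (swapOp F ε (Finsupp.single x 1)) =
      ((componentsOfExcess ε x).card : F) • Finsupp.single x 1 +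
        ∑ S ∈ componentsOfExcess ε x, ∑ T ∈ componentsOfExcess (-ε) x,
          Finsupp.single (swapOn T (swapOn S x)) 1 := by
  rw [swapOp_single, map_sum, Nat.cast_smul_eq_nsmul, ← Finset.sum_const,
    ← Finset.sum_add_distrib]
  refine Finset.sum_congr rfl fun S hS => ?_
  rw [swapOp_single, componentsOfExcess_neg_swapOn hS,
    Finset.sum_insert (not_mem_componentsOfExcess_neg hε hS), swapOn_swapOn_self]

lemma commutator_swapOp_swapOp :
    swapOp F (V := V) 1 * swapOp F (-1) - swapOp F (-1) * swapOp F 1 = weightOp F := by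
  refine Finsupp.lhom_ext' fun x => LinearMap.ext_ring ?_
  have h₁ := swapOp_neg_swapOp_single F one_ne_zero x
  have h₂ := swapOp_neg_swapOp_single F (neg_ne_zero.2 one_ne_zero : (-1 : ℤ) ≠ 0) x
  rw [neg_neg, Finset.sum_comm, Finset.sum_congr rfl fun S _ => Finset.sum_congr rfl fun T _ =>
    congrArg (Finsupp.single · (1 : F)) (swapOn_comm S T x)] at h₂
  simp only [LinearMap.comp_apply, Finsupp.lsingle_apply, LinearMap.sub_apply,
    Module.End.mul_apply]
  rw [h₁, h₂, weightOp_single, weight]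
  push_cast
  rw [sub_smul, add_sub_add_right_eq_sub]

lemma commutator_weightOp_swapOp {ε : ℤ} {c : F} (h : ∀ x : Finset (Sym2 V) × Finset (Sym2 V),
    ∀ S ∈ componentsOfExcess ε x, (weight (swapOn S x) : F) = weight x + c) :
    weightOp F * swapOp F ε - swapOp F ε * weightOp F = c • swapOp F (V := V) ε := by
  refine Finsupp.lhom_ext' fun x => LinearMap.ext_ring ?_
  simp only [LinearMap.comp_apply, Finsupp.lsingle_apply, LinearMap.sub_apply,
    Module.End.mul_apply, LinearMap.smul_apply]
  rw [weightOp_single, map_smul, swapOp_single, map_sum, Finset.smul_sum, Finset.smul_sum,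
    ← Finset.sum_sub_distrib]
  refine Finset.sum_congr rfl fun S hS => ?_
  rw [weightOp_single, h x S hS, add_smul, add_sub_cancel_left]

attribute [local instance] LieRing.ofAssociativeRing

lemma isSl2Triple (h : weightOp F (V := V) ≠ 0) :
    IsSl2Triple (weightOp F (V := V)) (swapOp F 1) (swapOp F (-1)) where
  h_ne_zero := h
  lie_e_f := commutator_swapOp_swapOp F
  lie_h_e_nsmul := by
    rw [LieRing.of_associative_ring_bracket, commutator_weightOp_swapOp F (c := 2),
      ← Nat.cast_smul_eq_nsmul F, Nat.cast_ofNat]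
    intro x S hS
    rw [weight_swapOn_of_mem_one hS]
    push_cast
    rfl
  lie_h_f_nsmul := by
    refine (commutator_weightOp_swapOp F (c := -2) fun x S hS => ?_).trans ?_
    · rw [weight_swapOn_of_mem_neg_one hS]
      push_cast
      ring
    · rw [← Nat.cast_smul_eq_nsmul F, Nat.cast_ofNat]
      exact neg_smul (2 : F) (swapOp F (V := V) (-1))

lemma eq_zero_of_swapOp_eq_zero [CharZero F] {n : ℕ} (hn : 0 < n)
    {v : Finset (Sym2 V) × Finset (Sym2 V) →₀ F} (hw : weightOp F v = (-n : F) • v)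
    (hv : swapOp F 1 v = 0) : v = 0 := by
  by_contra hne
  have hn' : (n : F) ≠ 0 := Nat.cast_ne_zero.2 hn.ne'
  have h : weightOp F (V := V) ≠ 0 := by
    rintro h
    rw [h, LinearMap.zero_apply, eq_comm, smul_eq_zero, neg_eq_zero] at hw
    exact hw.elim hn' hne
  have hp : (isSl2Triple F h).HasPrimitiveVectorWith v (-n : F) := ⟨hne, hw, hv⟩
  obtain ⟨m, hm⟩ := hp.exists_nat
  rw [neg_eq_iff_add_eq_zero] at hm
  norm_cast at hm
  omega

end Operators

section Equivariance

/-- A permutation of the vertices is an isomorphism between the union graphs of a pair of edge sets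
and of its image. -/
def unionGraphIso (φ : V ≃ V) (x : Finset (Sym2 V) × Finset (Sym2 V)) :
    unionGraph x ≃g unionGraph (mapPair φ x) where
  toEquiv := φ
  map_rel_iff' := by
    intro a b
    simp only [unionGraph, mapPair, SimpleGraph.fromEdgeSet_adj, ← Finset.image_union,
      Finset.mem_coe, ← Sym2.map_mk, ne_eq, φ.injective.eq_iff,
      (Sym2.map.injective φ.injective).mem_finset_image]

lemma map_mem_componentsOfExcess_iff (φ : V ≃ V) {ε : ℤ} {S : Finset V}
    {x : Finset (Sym2 V) × Finset (Sym2 V)} :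
    S.map φ.toEmbedding ∈ componentsOfExcess ε (mapPair φ x) ↔ S ∈ componentsOfExcess ε x := by
  rw [mem_componentsOfExcess, mem_componentsOfExcess, excess_mapPair,
    ← SimpleGraph.map_mem_componentSets_iff (unionGraphIso φ x)]
  rfl

lemma swapOp_comp_lmapDomain (F : Type*) [Field F] (φ : V ≃ V) (ε : ℤ) :
    swapOp F ε ∘ₗ Finsupp.lmapDomain F F (mapPair φ) =
      Finsupp.lmapDomain F F (mapPair φ) ∘ₗ swapOp F ε := by
  refine Finsupp.lhom_ext' fun x => LinearMap.ext_ring ?_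
  simp only [LinearMap.comp_apply, Finsupp.lsingle_apply, Finsupp.lmapDomain_apply,
    Finsupp.mapDomain_single, swapOp_single, Finsupp.mapDomain_finsetSum]
  refine (Finset.sum_equiv (Equiv.finsetCongr φ) (fun S => ?_) fun S _ => ?_).symm
  · exact (map_mem_componentsOfExcess_iff φ).symm
  · rw [Equiv.finsetCongr_apply, swapOn_mapPair]

end Equivariance

end Components

section Embedding

variable (F : Type*) [Field F] (G : SimpleGraph V) (i j : ℕ)

lemma embed_comp_map_actV (σ : G ≃g G) :
    embed F G i j ∘ₗ TensorProduct.map (actV F σ i) (actV F σ j) =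
      Finsupp.lmapDomain F F (mapPair σ.toEquiv) ∘ₗ embed F G i j := by
  refine tensor_hom_ext fun M N => ?_
  simp only [LinearMap.comp_apply, TensorProduct.map_tmul, actV, Finsupp.lmapDomain_apply,
    Finsupp.mapDomain_single, embed_single_tmul_single]
  rfl

variable [Fintype V]

lemma weightOp_comp_embed :
    weightOp F ∘ₗ embed F G i j = ((i : F) - j) • embed F G i j := by
  refine tensor_hom_ext fun M N => ?_
  rw [LinearMap.comp_apply, LinearMap.smul_apply, embed_single_tmul_single, weightOp_single,
    weight_eq_card_sub_card M.2.1 N.2.1, M.2.2, N.2.2]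
  push_cast
  rfl

lemma swapOp_embed_mem_range (v : TensorProduct F (MatchRep F G i) (MatchRep F G (j + 1))) :
    swapOp F 1 (embed F G i (j + 1) v) ∈ LinearMap.range (embed F G (i + 1) j) := by
  suffices h : (LinearMap.range (embed F G (i + 1) j)).mkQ ∘ₗ swapOp F 1 ∘ₗ
      embed F G i (j + 1) = 0 by
    simpa using LinearMap.congr_fun h v
  refine tensor_hom_ext fun M N => ?_
  simp only [LinearMap.comp_apply, LinearMap.zero_apply, Submodule.mkQ_apply,
    Submodule.Quotient.mk_eq_zero]
  rw [embed_single_tmul_single, swapOp_single]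
  refine Submodule.sum_mem _ fun S hS => ?_
  obtain ⟨hS, hexc⟩ := mem_componentsOfExcess.1 hS
  have hfst := card_swapOn_fst S (M.val, N.val)
  have hsnd := card_swapOn_snd S (M.val, N.val)
  rw [hexc] at hfst hsnd
  have hM : (M.val).card = i := M.2.2
  have hN : (N.val).card = j + 1 := N.2.2
  exact ⟨_, embed_single_tmul_single F G (i + 1) j
    ⟨_, isMatching_swapOn_fst (x := (M.val, N.val)) M.2.1 N.2.1 hS, by dsimp only at *; omega⟩
    ⟨_, isMatching_swapOn_snd (x := (M.val, N.val)) M.2.1 N.2.1 hS, by dsimp only at *; omega⟩⟩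

end Embedding

end MatchingPair

/-- **Strong equivariant log-concavity of graph matchings.** For every finite simple graph
`G` and all `1 ≤ ℓ ≤ k`, there is an injective `Aut(G)`-equivariant linear map
`V_{ℓ-1} ⊗ V_{k+1} → V_ℓ ⊗ V_k`. -/
theorem strongly_equivariantly_log_concave
    (F : Type) [Field F] [CharZero F]
    (V : Type) [Fintype V] [DecidableEq V] (G : SimpleGraph V)
    (ℓ k : ℕ) (hℓ : 1 ≤ ℓ) (hℓk : ℓ ≤ k) :
    ∃ Φ : TensorProduct F (MatchRep F G (ℓ - 1)) (MatchRep F G (k + 1)) →ₗ[F]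
          TensorProduct F (MatchRep F G ℓ) (MatchRep F G k),
      Function.Injective Φ ∧
      ∀ σ : G ≃g G,
        Φ ∘ₗ TensorProduct.map (actV F σ (ℓ - 1)) (actV F σ (k + 1)) =
          TensorProduct.map (actV F σ ℓ) (actV F σ k) ∘ₗ Φ := by
  obtain ⟨i, rfl⟩ : ∃ i, ℓ = i + 1 := ⟨ℓ - 1, by omega⟩
  change ∃ Φ : TensorProduct F (MatchRep F G i) (MatchRep F G (k + 1)) →ₗ[F] _, _ ∧
    ∀ σ : G ≃g G, Φ ∘ₗ TensorProduct.map (actV F σ i) (actV F σ (k + 1)) = _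
  have hinj := MatchingPair.embed_injective F G (i + 1) k
  let Φ := (LinearEquiv.ofInjective _ hinj).symm.toLinearMap ∘ₗ
    LinearMap.codRestrict _ (MatchingPair.swapOp F 1 ∘ₗ MatchingPair.embed F G i (k + 1))
      (MatchingPair.swapOp_embed_mem_range F G i k)
  have hΦ : ∀ v, MatchingPair.embed F G (i + 1) k (Φ v) =
      MatchingPair.swapOp F 1 (MatchingPair.embed F G i (k + 1) v) := fun v =>
    congrArg Subtype.val ((LinearEquiv.ofInjective _ hinj).apply_symm_apply _)
  refine ⟨Φ, fun u v huv => ?_, fun σ => LinearMap.ext fun v => ?_⟩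
  · refine MatchingPair.embed_injective F G i (k + 1) <| sub_eq_zero.1 <|
      MatchingPair.eq_zero_of_swapOp_eq_zero F (n := k + 1 - i) (by omega) ?_ ?_
    · have h := LinearMap.congr_fun (MatchingPair.weightOp_comp_embed F G i (k + 1))
      simp only [LinearMap.comp_apply, LinearMap.smul_apply] at h
      rw [map_sub, h, h, ← smul_sub, Nat.cast_sub (by omega), neg_sub]
    · rw [map_sub, ← hΦ, ← hΦ, huv, sub_self]
  · apply hinj
    have h₁ := LinearMap.congr_fun (MatchingPair.embed_comp_map_actV F G i (k + 1) σ) v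
    have h₂ := LinearMap.congr_fun (MatchingPair.embed_comp_map_actV F G (i + 1) k σ) (Φ v)
    have h₃ := LinearMap.congr_fun (MatchingPair.swapOp_comp_lmapDomain F σ.toEquiv 1)
      (MatchingPair.embed F G i (k + 1) v)
    simp only [LinearMap.comp_apply] at h₁ h₂ h₃ ⊢
    rw [hΦ, h₁, h₂, h₃, hΦ]
end

section
/- For every finite simple graph G and all integers 1 ≤ ℓ ≤ k ≤ r_G, the matching numbers satisfy m_{ℓ-1} · m_{k+1} ≤ m_{ℓ} · m_{k}. In particular (taking ℓ = k), the sequence (m_k) of matching numbers of G is log-concave: m_{k-1} · m_{k+1} ≤ m_k² for all 1 ≤ k ≤ r_G. -/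
/-- `m_k`, the number of matchings of size `k` on `G`. -/
noncomputable def matchingNumber {V : Type*} (G : SimpleGraph V) (k : ℕ) : ℕ :=
  Nat.card (Matchings G k)

/-- `r_G`, the size of a maximum matching of `G`. -/
noncomputable def maxMatchingSize {V : Type*} (G : SimpleGraph V) : ℕ :=
  sSup {k : ℕ | ∃ M : Finset (Sym2 V), IsMatching G M ∧ M.card = k}

open Polynomial

/-- A real polynomial whose coefficients are nonnegative and satisfy
`a_i * a_{k+1} ≤ a_{i+1} * a_k` for all `i < k`. -/
def HasLogConcaveCoeffs (p : ℝ[X]) : Prop :=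
  (∀ k, 0 ≤ p.coeff k) ∧
    ∀ i k, i < k → p.coeff i * p.coeff (k + 1) ≤ p.coeff (i + 1) * p.coeff k

theorem HasLogConcaveCoeffs.mul_X_add_C {p : ℝ[X]} (hp : HasLogConcaveCoeffs p) {c : ℝ}
    (hc : 0 ≤ c) : HasLogConcaveCoeffs (p * (X + C c)) := by
  obtain ⟨h0, h⟩ := hp
  have hzero : (p * (X + C c)).coeff 0 = c * p.coeff 0 := by simp [mul_add, mul_comm]
  have hsucc (k : ℕ) : (p * (X + C c)).coeff (k + 1) = p.coeff k + c * p.coeff (k + 1) := by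
    simp [mul_add, mul_comm c]
  refine ⟨fun k => ?_, fun i k hik => ?_⟩
  · cases k with
    | zero => rw [hzero]; exact mul_nonneg hc (h0 _)
    | succ k => rw [hsucc]; exact add_nonneg (h0 _) (mul_nonneg hc (h0 _))
  · obtain ⟨j, rfl⟩ : ∃ j, k = j + 1 := ⟨k - 1, by omega⟩
    cases i with
    | zero =>
      rw [hzero, hsucc, hsucc, hsucc]
      have h1 := mul_le_mul_of_nonneg_left (h 0 (j + 1) (by omega)) (mul_nonneg hc hc)
      have h2 := mul_nonneg (h0 0) (h0 j)
      have h3 := mul_nonneg hc (mul_nonneg (h0 (0 + 1)) (h0 j))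
      linear_combination h1 + h2 + h3
    | succ a =>
      rw [hsucc, hsucc, hsucc, hsucc]
      have h1 := h a j (by omega)
      have h2 := mul_le_mul_of_nonneg_left (h (a + 1) (j + 1) (by omega)) (mul_nonneg hc hc)
      have h3 : p.coeff a * p.coeff (j + 1 + 1) ≤ p.coeff (a + 1 + 1) * p.coeff j := by
        refine (h a (j + 1) (by omega)).trans ?_
        obtain rfl | hlt : a + 1 = j ∨ a + 1 < j := by omega
        · exact (mul_comm _ _).le
        · exact h (a + 1) j hlt
      linear_combination h1 + h2 + c * h3

theorem hasLogConcaveCoeffs_C {a : ℝ} (ha : 0 ≤ a) : HasLogConcaveCoeffs (C a) := by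
  refine ⟨fun k => ?_, fun i k _ => by simp [coeff_C]⟩
  rw [coeff_C]
  split_ifs <;> simp [ha]

theorem Polynomial.Splits.hasLogConcaveCoeffs {p : ℝ[X]} (hp : p.Splits)
    (hlead : 0 ≤ p.leadingCoeff) (hroots : ∀ r ∈ p.roots, r ≤ 0) : HasLogConcaveCoeffs p := by
  have key (s : Multiset ℝ) (hs : ∀ r ∈ s, r ≤ 0) :
      HasLogConcaveCoeffs (C p.leadingCoeff * (s.map (X - C ·)).prod) := by
    induction s using Multiset.induction_on with
    | empty => simpa using hasLogConcaveCoeffs_C hlead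
    | cons r s ih =>
      have hmul := (ih fun x hx => hs x (Multiset.mem_cons_of_mem hx)).mul_X_add_C
        (neg_nonneg.mpr (hs r (Multiset.mem_cons_self r s)))
      rw [C_neg, ← sub_eq_add_neg, mul_assoc, mul_comm _ (X - C r)] at hmul
      simpa using hmul
  rw [hp.eq_prod_roots]
  exact key _ hroots

theorem hasLogConcaveCoeffs_of_complex_roots {p : ℝ[X]} (hlead : 0 ≤ p.leadingCoeff)
    (hroots : ∀ z : ℂ, aeval z p = 0 → ∃ r : ℝ, r ≤ 0 ∧ (r : ℂ) = z) :
    HasLogConcaveCoeffs p := by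
  refine Splits.hasLogConcaveCoeffs ?_ hlead fun r hr => ?_
  · refine Splits.of_splits_map (algebraMap ℝ ℂ) (IsAlgClosed.splits _) fun z hz => ?_
    obtain ⟨r, -, hr⟩ := hroots z (by
      rw [← eval_map_algebraMap]
      exact (mem_roots'.mp hz).2)
    exact ⟨r, hr⟩
  · obtain ⟨s, hs, hsr⟩ := hroots r (by
      have h := aeval_algebraMap_apply ℂ r p
      rw [coe_aeval_eq_eval, (mem_roots'.mp hr).2, map_zero] at h
      exact h)
    rwa [← Complex.ofReal_injective hsr]

section MatchingPolynomial

open Classical in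
/-- The matchings of `G` all of whose edges lie inside `W`. -/
noncomputable def matchingsWithin {V : Type*} [Fintype V] (G : SimpleGraph V) (W : Finset V) :
    Finset (Finset (Sym2 V)) :=
  Finset.univ.filter fun M => IsMatching G M ∧ ∀ e ∈ M, ∀ v ∈ e, v ∈ W

/-- The matching generating function of the subgraph of `G` induced on `W`. -/
noncomputable def matchingPoly {V : Type*} [Fintype V] (G : SimpleGraph V) (W : Finset V) :
    ℝ[X] :=
  ∑ M ∈ matchingsWithin G W, X ^ M.card

variable {V : Type*} [Fintype V] {G : SimpleGraph V}

theorem mem_matchingsWithin {W : Finset V} {M : Finset (Sym2 V)} :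
    M ∈ matchingsWithin G W ↔ IsMatching G M ∧ ∀ e ∈ M, ∀ v ∈ e, v ∈ W := by
  simp [matchingsWithin]

theorem coeff_matchingPoly_univ (k : ℕ) :
    (matchingPoly G Finset.univ).coeff k = matchingNumber G k := by
  classical
  have hcard : matchingNumber G k =
      ((matchingsWithin G Finset.univ).filter fun M => k = M.card).card := by
    rw [matchingNumber, Matchings, Nat.card_eq_fintype_card, Fintype.card_subtype]
    congr 1
    ext M
    simp [mem_matchingsWithin, eq_comm]
  simp [matchingPoly, finsetSum_coeff, coeff_X_pow, hcard]

theorem coeff_matchingPoly_nonneg (W : Finset V) (k : ℕ) : 0 ≤ (matchingPoly G W).coeff k := by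
  rw [matchingPoly, finsetSum_coeff]
  refine Finset.sum_nonneg fun M _ => ?_
  rw [coeff_X_pow]
  split_ifs <;> simp

theorem matchingPoly_empty : matchingPoly G ∅ = 1 := by
  have h : matchingsWithin G ∅ = {∅} := by
    ext M
    rw [mem_matchingsWithin, Finset.mem_singleton]
    constructor
    · rintro ⟨-, hM⟩
      refine Finset.eq_empty_of_forall_notMem fun e he => ?_
      induction e with
      | _ a b => simpa using hM _ he a (Sym2.mem_mk_left a b)
    · rintro rfl
      simp [IsMatching]
  simp [matchingPoly, h]

theorem notMem_of_mem_matchingsWithin {W : Finset V} {v : V} (hv : v ∉ W)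
    {M : Finset (Sym2 V)} (hM : M ∈ matchingsWithin G W) {e : Sym2 V} (he : v ∈ e) : e ∉ M :=
  fun heM => hv ((mem_matchingsWithin.mp hM).2 e heM v he)

variable [DecidableEq V]

theorem insert_mem_matchingsWithin {W : Finset V} {u v : V} (hv : v ∈ W) (hu : u ∈ W)
    (huv : G.Adj v u) {M : Finset (Sym2 V)} (hM : M ∈ matchingsWithin G ((W.erase v).erase u)) :
    insert s(v, u) M ∈ matchingsWithin G W := by
  rw [mem_matchingsWithin] at hM ⊢
  obtain ⟨⟨hG, hdisj⟩, hW⟩ := hM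
  refine ⟨⟨?_, ?_⟩, ?_⟩
  · intro e he
    simp only [Finset.coe_insert, Set.mem_insert_iff] at he
    rcases he with rfl | he
    · exact huv
    · exact hG he
  · intro e he f hf hef x hxe hxf
    rw [Finset.mem_insert] at he hf
    rcases he with rfl | he <;> rcases hf with rfl | hf
    · exact hef rfl
    · have := hW f hf x hxf
      simp only [Sym2.mem_iff, Finset.mem_erase] at hxe this
      tauto
    · have := hW e he x hxe
      simp only [Sym2.mem_iff, Finset.mem_erase] at hxf this
      tauto
    · exact hdisj e he f hf hef x hxe hxf
  · intro e he x hx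
    rw [Finset.mem_insert] at he
    rcases he with rfl | he
    · rcases Sym2.mem_iff.mp hx with rfl | rfl <;> assumption
    · exact Finset.mem_of_mem_erase (Finset.mem_of_mem_erase (hW e he x hx))

theorem erase_mem_matchingsWithin {W : Finset V} {u v : V} {M : Finset (Sym2 V)}
    (hM : M ∈ matchingsWithin G W) (huv : s(v, u) ∈ M) :
    M.erase s(v, u) ∈ matchingsWithin G ((W.erase v).erase u) := by
  rw [mem_matchingsWithin] at hM ⊢
  obtain ⟨⟨hG, hdisj⟩, hW⟩ := hM
  refine ⟨⟨fun e he => hG (Finset.mem_of_mem_erase he), fun e he f hf =>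
    hdisj e (Finset.mem_of_mem_erase he) f (Finset.mem_of_mem_erase hf)⟩, fun e he x hx => ?_⟩
  obtain ⟨hne, he⟩ := Finset.mem_erase.mp he
  have hx' := hdisj e he _ huv hne x hx
  simp only [Sym2.mem_iff, not_or] at hx'
  simp [hx', hW e he x hx]

open Classical in
/-- A matching within `W` either avoids the vertex `v` or contains a unique edge at `v`. -/
theorem matchingPoly_eq_erase_add {W : Finset V} {v : V} (hv : v ∈ W) :
    matchingPoly G W = matchingPoly G (W.erase v) +
      X * ∑ u ∈ (W.erase v).filter (G.Adj v), matchingPoly G ((W.erase v).erase u) := by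
  have havoid : (matchingsWithin G W).filter (fun M => ∀ e ∈ M, v ∉ e) =
      matchingsWithin G (W.erase v) := by
    ext M
    simp only [Finset.mem_filter, mem_matchingsWithin, Finset.mem_erase]
    constructor
    · rintro ⟨⟨hM, hW⟩, hvM⟩
      exact ⟨hM, fun e he x hx => ⟨fun h => hvM e he (h ▸ hx), hW e he x hx⟩⟩
    · rintro ⟨hM, hW⟩
      exact ⟨⟨hM, fun e he x hx => (hW e he x hx).2⟩, fun e he hve => (hW e he v hve).1 rfl⟩
  rw [matchingPoly, ← Finset.sum_filter_add_sum_filter_not _ (fun M => ∀ e ∈ M, v ∉ e), havoid]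
  congr 1
  simp only [matchingPoly, Finset.mul_sum]
  rw [Finset.sum_sigma']
  symm
  have hfresh (p : (_ : V) × Finset (Sym2 V))
      (hp : p ∈ ((W.erase v).filter (G.Adj v)).sigma
        fun u => matchingsWithin G ((W.erase v).erase u)) (u : V) : s(v, u) ∉ p.2 :=
    notMem_of_mem_matchingsWithin (by simp) (Finset.mem_sigma.mp hp).2 (Sym2.mem_mk_left v u)
  refine Finset.sum_bij (fun p _ => insert s(v, p.1) p.2) ?_ ?_ ?_ ?_
  · intro p hp
    obtain ⟨hu, hM⟩ := Finset.mem_sigma.mp hp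
    obtain ⟨huW, hadj⟩ := Finset.mem_filter.mp hu
    refine Finset.mem_filter.mpr ⟨insert_mem_matchingsWithin hv (Finset.mem_of_mem_erase huW)
      hadj hM, fun h => h _ (Finset.mem_insert_self _ _) (Sym2.mem_mk_left _ _)⟩
  · rintro ⟨u, M⟩ hp ⟨u', M'⟩ hp' heq
    have hM := hfresh _ hp
    have hM' := hfresh _ hp'
    dsimp only at heq hM hM'
    have hmem : s(v, u) ∈ insert s(v, u') M' := heq ▸ Finset.mem_insert_self _ _
    obtain rfl : u = u' :=
      Sym2.congr_right.mp ((Finset.mem_insert.mp hmem).resolve_right (hM' u))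
    have hMM' : M = M' := by
      rw [← Finset.erase_insert (hM u), heq, Finset.erase_insert (hM' u)]
    rw [hMM']
  · intro M hM
    obtain ⟨hM, hvM⟩ := Finset.mem_filter.mp hM
    push Not at hvM
    obtain ⟨e, he, hve⟩ := hvM
    obtain ⟨u, rfl⟩ := hve
    obtain ⟨⟨hG, -⟩, hW⟩ := mem_matchingsWithin.mp hM
    have hadj : G.Adj v u := hG he
    refine ⟨⟨u, M.erase s(v, u)⟩, ?_, Finset.insert_erase he⟩
    simp only [Finset.mem_sigma, Finset.mem_filter, Finset.mem_erase]
    exact ⟨⟨⟨hadj.ne', hW _ he u (Sym2.mem_mk_right v u)⟩, hadj⟩,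
      erase_mem_matchingsWithin hM he⟩
  · intro p hp
    rw [Finset.card_insert_of_notMem (hfresh p hp p.1), pow_succ']

/-- The Heilmann–Lieb argument: matching polynomials do not vanish at squares of complex numbers
with positive real part. -/
theorem matchingPoly_stable {y : ℂ} (hy : 0 < y.re) (W : Finset V) :
    aeval (y ^ 2) (matchingPoly G W) ≠ 0 ∧ ∀ v ∈ W,
      0 < (y⁻¹ * (aeval (y ^ 2) (matchingPoly G W) /
        aeval (y ^ 2) (matchingPoly G (W.erase v)))).re := by
  classical
  have inv_re_pos {z : ℂ} (hz : 0 < z.re) : 0 < z⁻¹.re := by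
    rw [Complex.inv_re]
    exact div_pos hz (Complex.normSq_pos.mpr fun h => by simp [h] at hz)
  have hy0 : y ≠ 0 := fun h => by simp [h] at hy
  induction W using Finset.strongInduction with
  | H W ih =>
    have hratio (v : V) (hv : v ∈ W) : 0 < (y⁻¹ * (aeval (y ^ 2) (matchingPoly G W) /
        aeval (y ^ 2) (matchingPoly G (W.erase v)))).re := by
      obtain ⟨hne, hpos⟩ := ih _ (Finset.erase_ssubset hv)
      have hexpand : y⁻¹ * (aeval (y ^ 2) (matchingPoly G W) /
          aeval (y ^ 2) (matchingPoly G (W.erase v))) =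
          y⁻¹ + ∑ u ∈ (W.erase v).filter (G.Adj v),
            (y⁻¹ * (aeval (y ^ 2) (matchingPoly G (W.erase v)) /
              aeval (y ^ 2) (matchingPoly G ((W.erase v).erase u))))⁻¹ := by
        simp only [mul_inv, inv_inv, inv_div, ← Finset.mul_sum, ← Finset.sum_div]
        rw [matchingPoly_eq_erase_add hv, map_add, map_mul, aeval_X, map_sum]
        field_simp
      rw [hexpand, Complex.add_re, Complex.re_sum]
      exact add_pos_of_pos_of_nonneg (inv_re_pos hy) (Finset.sum_nonneg fun u hu =>
        (inv_re_pos (hpos u (Finset.mem_of_mem_filter u hu))).le)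
    refine ⟨?_, hratio⟩
    obtain rfl | ⟨v, hv⟩ := W.eq_empty_or_nonempty
    · simp [matchingPoly_empty]
    · intro h
      simpa [h] using hratio v hv

/-- The Heilmann–Lieb theorem: all roots of a matching polynomial are real and nonpositive. -/
theorem matchingPoly_root_nonpos {W : Finset V} {z : ℂ} (hz : aeval z (matchingPoly G W) = 0) :
    ∃ r : ℝ, r ≤ 0 ∧ (r : ℂ) = z := by
  obtain ⟨y, rfl⟩ := IsAlgClosed.exists_pow_nat_eq z zero_lt_two
  obtain hy | hy | hy := lt_trichotomy y.re 0
  · exact absurd (by rwa [neg_sq]) (matchingPoly_stable (y := -y) (by simpa using hy) W).1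
  · refine ⟨-y.im ^ 2, neg_nonpos.mpr (sq_nonneg _), ?_⟩
    apply Complex.ext <;> simp [pow_two, hy]
  · exact absurd hz (matchingPoly_stable hy W).1

theorem hasLogConcaveCoeffs_matchingPoly (W : Finset V) :
    HasLogConcaveCoeffs (matchingPoly G W) :=
  hasLogConcaveCoeffs_of_complex_roots (coeff_matchingPoly_nonneg W _) fun _ hz =>
    matchingPoly_root_nonpos hz

end MatchingPolynomial

/-- **Log-concavity of graph matching numbers**: for a finite simple graph `G` and
`1 ≤ ℓ ≤ k ≤ r_G`, one has `m_{ℓ-1} · m_{k+1} ≤ m_ℓ · m_k`. -/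
theorem matchingNumber_log_concave
    (V : Type) [Fintype V] [DecidableEq V] (G : SimpleGraph V)
    (ℓ k : ℕ) (hℓ : 1 ≤ ℓ) (hℓk : ℓ ≤ k) (hk : k ≤ maxMatchingSize G) :
    matchingNumber G (ℓ - 1) * matchingNumber G (k + 1) ≤
      matchingNumber G ℓ * matchingNumber G k := by
  have h := (hasLogConcaveCoeffs_matchingPoly (G := G) Finset.univ).2 (ℓ - 1) k (by omega)
  simp only [coeff_matchingPoly_univ, Nat.sub_add_cancel hℓ] at h
  exact_mod_cast h
end

section
/- The Boolean lattice on an n-element set E has property T: for every integer i with 0 ≤ i ≤ ⌊n/2⌋, there exist C(n,i) pairwise disjoint saturated chains from the i-th level to the (n-i)-th level; that is, there is a family, indexed by the i-element subsets S of E, of chains S = X_i ⊊ X_{i+1} ⊊ ⋯ ⊊ X_{n-i} with |X_j| = j for all i ≤ j ≤ n-i, such that no subset of E occurs in two distinct chains of the family. -/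
/-- A symmetric chain decomposition of the subsets of `s`: the chain through `S` has bottom rank
`r S` and its member of rank `j` is `X S j`. -/
structure IsSymmChainDecomp {α : Type*} (s : Finset α) (r : Finset α → ℕ)
    (X : Finset α → ℕ → Finset α) : Prop where
  bot_le : ∀ S ⊆ s, r S ≤ S.card
  le_top : ∀ S ⊆ s, S.card + r S ≤ s.card
  self : ∀ S ⊆ s, X S S.card = S
  subset : ∀ S ⊆ s, ∀ j, r S ≤ j → j + r S ≤ s.card → X S j ⊆ s
  card : ∀ S ⊆ s, ∀ j, r S ≤ j → j + r S ≤ s.card → (X S j).card = j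
  bot_eq : ∀ S ⊆ s, ∀ j, r S ≤ j → j + r S ≤ s.card → r (X S j) = r S
  chain_eq : ∀ S ⊆ s, ∀ j, r S ≤ j → j + r S ≤ s.card → X (X S j) = X S
  mono : ∀ S ⊆ s, ∀ j, r S ≤ j → j + 1 + r S ≤ s.card → X S j ⊆ X S (j + 1)

/-- Adjoining a point `a` splits each chain `C_r ⊂ ⋯ ⊂ C_m` into the two chains
`C_r ⊂ ⋯ ⊂ C_m ⊂ C_m ∪ {a}` and `C_r ∪ {a} ⊂ ⋯ ⊂ C_{m-1} ∪ {a}`. -/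
theorem IsSymmChainDecomp.exists_insert {α : Type*} [DecidableEq α] {s : Finset α}
    {r : Finset α → ℕ} {X : Finset α → ℕ → Finset α} (h : IsSymmChainDecomp s r X)
    {a : α} (ha : a ∉ s) : ∃ r' X', IsSymmChainDecomp (insert a s) r' X' := by
  let ext : Finset α → ℕ → Finset α := fun S j =>
    if j + r S ≤ s.card then X S j else insert a (X S (s.card - r S))
  let P : Finset α → Prop := fun T => a ∈ T ∧ (T.erase a).card + r (T.erase a) < s.card
  classical
  let r' : Finset α → ℕ := fun T => if P T then r (T.erase a) + 1 else r (T.erase a)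
  let X' : Finset α → ℕ → Finset α := fun T =>
    if P T then fun j => insert a (X (T.erase a) (j - 1)) else ext (T.erase a)
  have hn : (insert a s).card = s.card + 1 := Finset.card_insert_of_notMem ha
  have notMem {S : Finset α} (hS : S ⊆ s) : a ∉ S := fun h' => ha (hS h')
  have low {S : Finset α} (hS : S ⊆ s) : r' S = r S ∧ X' S = ext S := by
    have hP : ¬ P S := fun h' => notMem hS h'.1
    simp [r', X', hP, Finset.erase_eq_of_notMem (notMem hS)]
  have top {S : Finset α} (hS : S ⊆ s) (hc : S.card + r S = s.card) :
      r' (insert a S) = r S ∧ X' (insert a S) = ext S := by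
    have hP : ¬ P (insert a S) := by
      simp [P, Finset.erase_insert (notMem hS), hc]
    simp [r', X', hP, Finset.erase_insert (notMem hS)]
  have high {S : Finset α} (hS : S ⊆ s) (hc : S.card + r S < s.card) :
      r' (insert a S) = r S + 1 ∧ X' (insert a S) = fun j => insert a (X S (j - 1)) := by
    have hP : P (insert a S) := by
      simp [P, Finset.erase_insert (notMem hS), hc]
    simp [r', X', hP, Finset.erase_insert (notMem hS)]
  have cases_subset {T : Finset α} (hT : T ⊆ insert a s) :
      (∃ S ⊆ s, r' T = r S ∧ X' T = ext S ∧
        (T = S ∨ T = insert a S ∧ S.card + r S = s.card)) ∨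
      ∃ S ⊆ s, S.card + r S < s.card ∧ T = insert a S := by
    by_cases haT : a ∈ T
    · have hS : T.erase a ⊆ s := Finset.subset_insert_iff.1 hT
      have hi := Finset.insert_erase haT
      rcases (h.le_top _ hS).lt_or_eq with hc | hc
      · exact .inr ⟨_, hS, hc, hi.symm⟩
      · refine .inl ⟨_, hS, ?_, ?_, .inr ⟨hi.symm, hc⟩⟩
        · simpa only [hi] using (top hS hc).1
        · simpa only [hi] using (top hS hc).2
    · have hS : T ⊆ s := (Finset.subset_insert_iff_of_notMem haT).1 hT
      exact .inl ⟨T, hS, (low hS).1, (low hS).2, .inl rfl⟩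
  have ext_spec {S : Finset α} (hS : S ⊆ s) (j : ℕ) (hj : r S ≤ j)
      (hj' : j + r S ≤ s.card + 1) :
      ext S j ⊆ insert a s ∧ (ext S j).card = j ∧ r' (ext S j) = r S ∧
        X' (ext S j) = ext S := by
    have key {k : ℕ} (hk : r S ≤ k) (hk' : k + r S ≤ s.card) : ext (X S k) = ext S := by
      simp only [ext, h.bot_eq S hS k hk hk', h.chain_eq S hS k hk hk']
    have hb := h.bot_le S hS
    have ht := h.le_top S hS
    by_cases hc : j + r S ≤ s.card
    · have e : ext S j = X S j := if_pos hc
      have hsub := h.subset S hS j hj hc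
      rw [e, (low hsub).1, (low hsub).2, key hj hc]
      exact ⟨hsub.trans (Finset.subset_insert a s), h.card S hS j hj hc,
        h.bot_eq S hS j hj hc, rfl⟩
    · have e : ext S j = insert a (X S (s.card - r S)) := if_neg hc
      have h1 : r S ≤ s.card - r S := by omega
      have h2 : s.card - r S + r S ≤ s.card := by omega
      have hsub := h.subset S hS _ h1 h2
      have hcard := h.card S hS _ h1 h2
      have hbot := h.bot_eq S hS _ h1 h2
      have htop := top hsub (by omega)
      rw [e, htop.1, htop.2, key h1 h2, Finset.card_insert_of_notMem (notMem hsub)]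
      exact ⟨Finset.insert_subset_insert a hsub, by omega, hbot, rfl⟩
  have ext_mono {S : Finset α} (hS : S ⊆ s) (j : ℕ) (hj : r S ≤ j)
      (hj' : j + 1 + r S ≤ s.card + 1) : ext S j ⊆ ext S (j + 1) := by
    have e : ext S j = X S j := if_pos (by omega)
    by_cases hc : j + 1 + r S ≤ s.card
    · rw [e, show ext S (j + 1) = X S (j + 1) from if_pos hc]
      exact h.mono S hS j hj hc
    · rw [e, show ext S (j + 1) = insert a (X S (s.card - r S)) from if_neg hc,
        show s.card - r S = j by omega]
      exact Finset.subset_insert _ _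
  have high_spec {S : Finset α} (hS : S ⊆ s) (j : ℕ) (hj : r S + 1 ≤ j)
      (hj' : j + r S ≤ s.card) :
      insert a (X S (j - 1)) ⊆ insert a s ∧ (insert a (X S (j - 1))).card = j ∧
        r' (insert a (X S (j - 1))) = r S + 1 ∧
        X' (insert a (X S (j - 1))) = fun k => insert a (X S (k - 1)) := by
    have h1 : r S ≤ j - 1 := by omega
    have h2 : j - 1 + r S ≤ s.card := by omega
    have hsub := h.subset S hS _ h1 h2
    have hcard := h.card S hS _ h1 h2
    have hbot := h.bot_eq S hS _ h1 h2
    have hhigh := high hsub (by omega)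
    rw [hhigh.1, hhigh.2, hbot, h.chain_eq S hS _ h1 h2,
      Finset.card_insert_of_notMem (notMem hsub)]
    exact ⟨Finset.insert_subset_insert a hsub, by omega, rfl, rfl⟩
  have spec {T : Finset α} (hT : T ⊆ insert a s) (j : ℕ) (hj : r' T ≤ j)
      (hj' : j + r' T ≤ (insert a s).card) :
      X' T j ⊆ insert a s ∧ (X' T j).card = j ∧ r' (X' T j) = r' T ∧ X' (X' T j) = X' T := by
    rw [hn] at hj'
    rcases cases_subset hT with ⟨S, hS, hr, hX, -⟩ | ⟨S, hS, hc, rfl⟩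
    · rw [hr] at hj hj' ⊢
      rw [hX]
      exact ext_spec hS j hj hj'
    · obtain ⟨hr, hX⟩ := high hS hc
      rw [hr] at hj hj' ⊢
      rw [hX]
      exact high_spec hS j hj (by omega)
  have bounds {T : Finset α} (hT : T ⊆ insert a s) :
      r' T ≤ T.card ∧ T.card + r' T ≤ s.card + 1 ∧ X' T T.card = T := by
    rcases cases_subset hT with ⟨S, hS, hr, hX, rfl | ⟨rfl, hc⟩⟩ | ⟨S, hS, hc, rfl⟩
    · have hb := h.bot_le T hS
      have ht := h.le_top T hS
      refine ⟨by omega, by omega, ?_⟩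
      rw [hX]
      exact (if_pos ht).trans (h.self T hS)
    · have hb := h.bot_le S hS
      rw [hr, hX, Finset.card_insert_of_notMem (notMem hS)]
      refine ⟨by omega, by omega, ?_⟩
      refine (if_neg (by omega)).trans ?_
      rw [show s.card - r S = S.card by omega, h.self S hS]
    · have hb := h.bot_le S hS
      obtain ⟨hr, hX⟩ := high hS hc
      rw [hr, hX, Finset.card_insert_of_notMem (notMem hS)]
      refine ⟨by omega, by omega, ?_⟩
      simp only [Nat.add_sub_cancel, h.self S hS]
  refine ⟨r', X', fun T hT => (bounds hT).1, fun T hT => hn ▸ (bounds hT).2.1,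
    fun T hT => (bounds hT).2.2, fun T hT j hj hj' => (spec hT j hj hj').1,
    fun T hT j hj hj' => (spec hT j hj hj').2.1, fun T hT j hj hj' => (spec hT j hj hj').2.2.1,
    fun T hT j hj hj' => (spec hT j hj hj').2.2.2, fun T hT j hj hj' => ?_⟩
  rw [hn] at hj'
  rcases cases_subset hT with ⟨S, hS, hr, hX, -⟩ | ⟨S, hS, hc, rfl⟩
  · rw [hr] at hj hj'
    rw [hX]
    exact ext_mono hS j hj hj'
  · obtain ⟨hr, hX⟩ := high hS hc
    rw [hr] at hj hj'
    rw [hX]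
    have := h.mono S hS (j - 1) (by omega) (by omega)
    rw [show j - 1 + 1 = j + 1 - 1 by omega] at this
    exact Finset.insert_subset_insert a this

theorem exists_isSymmChainDecomp {α : Type*} [DecidableEq α] (s : Finset α) :
    ∃ r X, IsSymmChainDecomp s r X := by
  induction s using Finset.induction_on with
  | empty =>
    refine ⟨fun _ => 0, fun _ _ => ∅, ?_⟩
    constructor <;> simp +contextual [Finset.subset_empty]
  | insert a s ha ih =>
    obtain ⟨r, X, h⟩ := ih
    exact h.exists_insert ha

/-- **Property T for the Boolean lattice.** For every finite set `E` with `n` elements and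
every `0 ≤ i ≤ ⌊n/2⌋`, there is a family, indexed by the `i`-element subsets `S` of `E`,
of saturated chains `S = X_i ⊊ X_{i+1} ⊊ ⋯ ⊊ X_{n-i}` with `|X_j| = j`, such that no
subset of `E` occurs in two distinct chains of the family. -/
theorem boolean_lattice_property_T
    (E : Type) [Fintype E] [DecidableEq E]
    (i : ℕ) (hi : i ≤ Fintype.card E / 2) :
    ∃ X : {S : Finset E // S.card = i} → ℕ → Finset E,
      (∀ S, X S i = S.val) ∧
      (∀ S j, i ≤ j → j ≤ Fintype.card E - i → (X S j).card = j) ∧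
      (∀ S j, i ≤ j → j < Fintype.card E - i → X S j ⊂ X S (j + 1)) ∧
      (∀ S S', S ≠ S' → ∀ j j', i ≤ j → j ≤ Fintype.card E - i →
        i ≤ j' → j' ≤ Fintype.card E - i → X S j ≠ X S' j') := by
  obtain ⟨r, X, h⟩ := exists_isSymmChainDecomp (Finset.univ : Finset E)
  have range {S : Finset E} (hS : S.card = i) {j : ℕ} (hj : i ≤ j)
      (hj' : j ≤ Fintype.card E - i) : r S ≤ j ∧ j + r S ≤ (Finset.univ : Finset E).card := by
    have := h.bot_le S (Finset.subset_univ S)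
    rw [Finset.card_univ]
    omega
  have card_eq (S : {S : Finset E // S.card = i}) (j : ℕ) (hj : i ≤ j)
      (hj' : j ≤ Fintype.card E - i) : (X S j).card = j :=
    h.card S (Finset.subset_univ _) j (range S.2 hj hj').1 (range S.2 hj hj').2
  have start (S : {S : Finset E // S.card = i}) : X S i = S.val := by
    simpa only [S.2] using h.self S (Finset.subset_univ _)
  refine ⟨fun S => X S, start, card_eq, fun S j hj hj' => ?_,
    fun S S' hne j j' hj hj₁ hj' hj₁' heq => hne ?_⟩
  · refine (h.mono S (Finset.subset_univ _) j (range S.2 hj hj'.le).1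
      (range S.2 (by omega) hj').2).ssubset_of_ne fun heq => ?_
    have := congrArg Finset.card heq
    rw [card_eq S j hj hj'.le, card_eq S (j + 1) (by omega) hj'] at this
    omega
  · have hX : X S = X S' := by
      rw [← h.chain_eq S (Finset.subset_univ _) j (range S.2 hj hj₁).1 (range S.2 hj hj₁).2,
        show X S j = X S' j' from heq,
        h.chain_eq S' (Finset.subset_univ _) j' (range S'.2 hj' hj₁').1 (range S'.2 hj' hj₁').2]
    exact Subtype.ext (by rw [← start S, hX, start S'])
end

section
/- Let M and M' be matchings on a finite simple graph G, and let C be the edge set of a connected component of the symmetric-difference graph D(M,M'). Then N := (M \ C) ∪ (M' ∩ C) and N' := (M' \ C) ∪ (M ∩ C) are again matchings on G; moreover |N| + |N'| = |M| + |M'|, and if C is a path component with exactly one more edge of M' than of M, then |N| = |M| + 1 and |N'| = |M'| − 1. -/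
/-- A matching on a simple graph `G`: a set of edges of `G` that are pairwise
disjoint (no two distinct edges share a vertex). -/
def IsMatchingSet {V : Type*} (G : SimpleGraph V) (M : Set (Sym2 V)) : Prop :=
  M ⊆ G.edgeSet ∧ ∀ e ∈ M, ∀ f ∈ M, e ≠ f → ∀ v, v ∈ e → v ∉ f

/-- The symmetric-difference graph `D(M,M')`: the graph on the vertex set of `G` whose
edges are the edges in the symmetric difference `M Δ M'`. -/
def symmDiffGraph {V : Type*} (M M' : Set (Sym2 V)) : SimpleGraph V :=
  SimpleGraph.fromEdgeSet (symmDiff M M')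

/-- The edge set of the connected component `c` of `D(M,M')`. -/
def compEdges {V : Type*} (M M' : Set (Sym2 V))
    (c : (symmDiffGraph M M').ConnectedComponent) : Set (Sym2 V) :=
  {e | e ∈ symmDiff M M' ∧ ∀ v ∈ e, v ∈ c.supp}

/-- The connected component `c` of `D(M,M')` is a path. -/
def IsPathComponent {V : Type*} (M M' : Set (Sym2 V))
    (c : (symmDiffGraph M M').ConnectedComponent) : Prop :=
  ∃ n : ℕ, Nonempty ((symmDiffGraph M M').induce c.supp ≃g SimpleGraph.pathGraph n)

/-- A pink chain: a path component of `D(M,M')` containing exactly one more edge of `M'`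
than of `M`. -/
def IsPinkChain {V : Type*} (M M' : Set (Sym2 V))
    (c : (symmDiffGraph M M').ConnectedComponent) : Prop :=
  IsPathComponent M M' c ∧
    (compEdges M M' c ∩ M').ncard = (compEdges M M' c ∩ M).ncard + 1

/-- A blue chain: a path component of `D(M,M')` containing exactly one more edge of `M`
than of `M'`. -/
def IsBlueChain {V : Type*} (M M' : Set (Sym2 V))
    (c : (symmDiffGraph M M').ConnectedComponent) : Prop :=
  IsPathComponent M M' c ∧
    (compEdges M M' c ∩ M).ncard = (compEdges M M' c ∩ M').ncard + 1

/-- `p`, the number of pink chains of `D(M,M')`. -/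
noncomputable def pinkCount {V : Type*} (M M' : Set (Sym2 V)) : ℕ :=
  Nat.card {c : (symmDiffGraph M M').ConnectedComponent // IsPinkChain M M' c}

/-- `b`, the number of blue chains of `D(M,M')`. -/
noncomputable def blueCount {V : Type*} (M M' : Set (Sym2 V)) : ℕ :=
  Nat.card {c : (symmDiffGraph M M').ConnectedComponent // IsBlueChain M M' c}

theorem mem_compEdges_of_mem_supp {V : Type*} {M M' : Set (Sym2 V)}
    {c : (symmDiffGraph M M').ConnectedComponent} {e : Sym2 V} {v : V}
    (he : e ∈ symmDiff M M') (hv : v ∈ e) (hc : v ∈ c.supp) : e ∈ compEdges M M' c := by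
  refine ⟨he, fun w hw => ?_⟩
  by_cases hvw : v = w
  · exact hvw ▸ hc
  · have hadj : (symmDiffGraph M M').Adj v w := by
      rw [symmDiffGraph, SimpleGraph.fromEdgeSet_adj]
      exact ⟨(Sym2.mem_and_mem_iff hvw).1 ⟨hv, hw⟩ ▸ he, hvw⟩
    exact (c.mem_supp_congr_adj hadj).1 hc

/-- If no edge of `symmDiff M M'` outside `C` meets an edge of `C`, then replacing the edges of
`M` in `C` by those of `M'` in `C` yields a matching. -/
theorem IsMatchingSet.swap {V : Type*} {G : SimpleGraph V} {M M' C : Set (Sym2 V)}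
    (hM : IsMatchingSet G M) (hM' : IsMatchingSet G M')
    (hC : ∀ e ∈ symmDiff M M', ∀ f ∈ C, ∀ v, v ∈ e → v ∈ f → e ∈ C) :
    IsMatchingSet G ((M \ C) ∪ (M' ∩ C)) := by
  have cross : ∀ e ∈ M \ C, ∀ f ∈ M' ∩ C, e ≠ f → ∀ v, v ∈ e → v ∉ f := by
    rintro e ⟨heM, heC⟩ f ⟨hfM', hfC⟩ hef v hve hvf
    by_cases heM' : e ∈ M'
    · exact hM'.2 e heM' f hfM' hef v hve hvf
    · exact heC (hC e (Or.inl ⟨heM, heM'⟩) f hfC v hve hvf)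
  refine ⟨Set.union_subset (Set.sdiff_subset.trans hM.1) (Set.inter_subset_left.trans hM'.1), ?_⟩
  rintro e (he | he) f (hf | hf) hef v hve hvf
  · exact hM.2 e he.1 f hf.1 hef v hve hvf
  · exact cross e he f hf hef v hve hvf
  · exact cross f hf e he hef.symm v hvf hve
  · exact hM'.2 e he.1 f hf.1 hef v hve hvf

theorem Set.ncard_sdiff_union_inter {α : Type*} [Finite α] (s t u : Set α) :
    ((s \ u) ∪ (t ∩ u)).ncard = (s \ u).ncard + (t ∩ u).ncard :=
  Set.ncard_union_eq (Set.disjoint_sdiff_left.mono_right Set.inter_subset_right)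

/-- Swapping the colors along a connected component `C` of the symmetric-difference graph
`D(M,M')` of two matchings yields matchings again: `N = (M \ C) ∪ (M' ∩ C)` and
`N' = (M' \ C) ∪ (M ∩ C)` are matchings on `G` with `|N| + |N'| = |M| + |M'|`; and if `C`
is a path component with exactly one more edge of `M'` than of `M`, then `|N| = |M| + 1`
and `|N'| = |M'| − 1`. -/
theorem swap_along_component
    (V : Type) [Fintype V] [DecidableEq V] (G : SimpleGraph V)
    (M M' : Set (Sym2 V)) (hM : IsMatchingSet G M) (hM' : IsMatchingSet G M')
    (c : (symmDiffGraph M M').ConnectedComponent) :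
    IsMatchingSet G ((M \ compEdges M M' c) ∪ (M' ∩ compEdges M M' c)) ∧
    IsMatchingSet G ((M' \ compEdges M M' c) ∪ (M ∩ compEdges M M' c)) ∧
    ((M \ compEdges M M' c) ∪ (M' ∩ compEdges M M' c)).ncard +
        ((M' \ compEdges M M' c) ∪ (M ∩ compEdges M M' c)).ncard =
      M.ncard + M'.ncard ∧
    (IsPinkChain M M' c →
      ((M \ compEdges M M' c) ∪ (M' ∩ compEdges M M' c)).ncard = M.ncard + 1 ∧
      ((M' \ compEdges M M' c) ∪ (M ∩ compEdges M M' c)).ncard = M'.ncard - 1) := by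
  have hC : ∀ e ∈ symmDiff M M', ∀ f ∈ compEdges M M' c, ∀ v, v ∈ e → v ∈ f →
      e ∈ compEdges M M' c :=
    fun e he f hf v hve hvf => mem_compEdges_of_mem_supp he hve (hf.2 v hvf)
  have hMcard := Set.ncard_inter_add_ncard_sdiff_eq_ncard M (compEdges M M' c)
  have hM'card := Set.ncard_inter_add_ncard_sdiff_eq_ncard M' (compEdges M M' c)
  rw [Set.ncard_sdiff_union_inter, Set.ncard_sdiff_union_inter]
  refine ⟨hM.swap hM' hC, hM'.swap hM (symmDiff_comm M M' ▸ hC), by lia, ?_⟩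
  rintro ⟨-, hpink⟩
  rw [Set.inter_comm _ M, Set.inter_comm _ M'] at hpink
  lia
end

section
/- Let E be a finite set with |E| = n ≥ 1 and let 0 ≤ i ≤ ⌊n/2⌋. Then the composition φ_{n-i-1} ∘ φ_{n-i-2} ∘ ⋯ ∘ φ_{i+1} ∘ φ_i : V_{E,i} → V_{E,n-i} of the normalized up-maps is an invertible (bijective) linear map. -/
/-- `V_{E,i}`, the `F`-vector space with basis indexed by the `i`-element subsets of `E`. -/
abbrev LevelRep (F : Type*) [Field F] (E : Type*) (i : ℕ) : Type _ :=
  {S : Finset E // S.card = i} →₀ F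

/-- The normalized up-map `φ_i : V_{E,i} → V_{E,i+1}` sending the basis vector `x_S` to
`(1/(n-i)) · Σ_{T ⊇ S, |T| = i+1} x_T`, where `n = |E|`. -/
noncomputable def phiUp (F : Type*) [Field F] (E : Type*) [Fintype E] [DecidableEq E]
    (i : ℕ) : LevelRep F E i →ₗ[F] LevelRep F E (i + 1) :=
  Finsupp.lift (LevelRep F E (i + 1)) F {S : Finset E // S.card = i}
    (fun S => (((Fintype.card E - i : ℕ) : F)⁻¹) •
      ∑ T : {T : Finset E // T.card = i + 1},
        if S.val ⊆ T.val then Finsupp.single T (1 : F) else 0)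

/-- The composition `φ_{a+j-1} ∘ ⋯ ∘ φ_{a+1} ∘ φ_a : V_{E,a} → V_{E,a+j}` of the
normalized up-maps. -/
noncomputable def phiUpIter (F : Type*) [Field F] (E : Type*) [Fintype E] [DecidableEq E]
    (a : ℕ) : (j : ℕ) → (LevelRep F E a →ₗ[F] LevelRep F E (a + j))
  | 0 => LinearMap.id
  | j + 1 => (phiUp F E (a + j)).comp (phiUpIter F E a j)

open Finset in
/-- The number of `k`-element sets between `S` and `T`. -/
theorem card_filter_subset_subset {E : Type*} [Fintype E] [DecidableEq E] {S T : Finset E}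
    (hST : S ⊆ T) {k : ℕ} (hk : S.card ≤ k) :
    (univ.filter fun U : {U : Finset E // U.card = k} => S ⊆ U.val ∧ U.val ⊆ T).card =
      (T.card - S.card).choose (k - S.card) := by
  rw [← card_sdiff_of_subset hST, ← card_powersetCard]
  refine card_bij' (fun U _ => U.val \ S)
    (fun A hA => ⟨A ∪ S, ?_⟩) ?_ ?_ ?_ ?_
  · rw [mem_powersetCard] at hA
    rw [card_union_of_disjoint (disjoint_of_subset_left hA.1 sdiff_disjoint), hA.2]
    omega
  · rintro ⟨U, hU⟩ h
    simp only [mem_filter, mem_univ, true_and] at h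
    rw [mem_powersetCard, card_sdiff_of_subset h.1, hU]
    exact ⟨sdiff_subset_sdiff h.2 subset_rfl, rfl⟩
  · intro A hA
    rw [mem_powersetCard] at hA
    simp only [mem_filter, mem_univ, true_and]
    exact ⟨subset_union_right, union_subset (hA.1.trans sdiff_subset) hST⟩
  · rintro ⟨U, hU⟩ h
    simp only [mem_filter, mem_univ, true_and] at h
    exact Subtype.ext (sdiff_union_of_subset h.1)
  · intro A hA
    rw [mem_powersetCard] at hA
    exact union_sdiff_cancel_right (disjoint_of_subset_left hA.1 sdiff_disjoint)

/-- Double counting of a weighted sum over a relation. -/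
theorem sum_ite_sum_ite {F α β : Type*} [Semiring F] [Fintype α] [Fintype β] (p : α → Prop)
    [DecidablePred p] (q : α → β → Prop) [∀ a, DecidablePred (q a)] (f : β → F) :
    ∑ a, (if p a then ∑ b, (if q a b then f b else 0) else 0) =
      ∑ b, ((Finset.univ.filter fun a => p a ∧ q a b).card : F) * f b := by
  have (a : α) : (if p a then ∑ b, (if q a b then f b else 0) else 0) =
      ∑ b, (if p a ∧ q a b then f b else 0) := by
    by_cases h : p a <;> simp [h]
  simp_rw [this]
  rw [Finset.sum_comm]
  refine Finset.sum_congr rfl fun b _ => ?_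
  rw [← Finset.sum_filter, Finset.sum_const, nsmul_eq_mul]

/-- The coordinates of `φ_i f`. -/
theorem phiUp_apply {F : Type*} [Field F] {E : Type*} [Fintype E] [DecidableEq E] (i : ℕ)
    (f : LevelRep F E i) (T : {T : Finset E // T.card = i + 1}) :
    phiUp F E i f T = ((Fintype.card E - i : ℕ) : F)⁻¹ *
      ∑ S : {S : Finset E // S.card = i}, if S.val ⊆ T.val then f S else 0 := by
  classical
  have key (S : {S : Finset E // S.card = i}) :
      (∑ U : {U : Finset E // U.card = i + 1},
        if S.val ⊆ U.val then Finsupp.single U (1 : F) else 0) T =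
        if S.val ⊆ T.val then 1 else 0 := by
    rw [Finsupp.finsetSum_apply, Finset.sum_eq_single T]
    · split_ifs <;> simp
    · intro U _ hU
      split_ifs <;> simp [hU]
    · simp
  rw [phiUp, Finsupp.lift_apply, Finsupp.sum_fintype _ _ (by simp), Finsupp.finsetSum_apply,
    Finset.mul_sum]
  refine Finset.sum_congr rfl fun S _ => ?_
  rw [Finsupp.smul_apply, Finsupp.smul_apply, key]
  split_ifs <;> simp [mul_comm]

/-- Up to a nonzero scalar, the composition of normalized up-maps is the inclusion matrix. -/
theorem exists_phiUpIter_apply {F : Type*} [Field F] [CharZero F] {E : Type*} [Fintype E]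
    [DecidableEq E] (a j : ℕ) (h : a + j ≤ Fintype.card E) :
    ∃ c : F, c ≠ 0 ∧ ∀ (f : LevelRep F E a) (T : {T : Finset E // T.card = a + j}),
      phiUpIter F E a j f T =
        c * ∑ S : {S : Finset E // S.card = a}, if S.val ⊆ T.val then f S else 0 := by
  induction j with
  | zero =>
    refine ⟨1, one_ne_zero, fun f T => ?_⟩
    rw [one_mul, Finset.sum_eq_single (⟨T.val, T.2⟩ : {S : Finset E // S.card = a})]
    · simp [phiUpIter]
    · intro S _ hS
      refine if_neg fun hST => hS (Subtype.ext ?_)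
      exact Finset.eq_of_subset_of_card_le hST (by rw [S.2, T.2, add_zero])
    · simp
  | succ j ih =>
    obtain ⟨c, hc, hf⟩ := ih (by omega)
    refine ⟨((Fintype.card E - (a + j) : ℕ) : F)⁻¹ * (c * (j + 1 : ℕ)), ?_, fun f T => ?_⟩
    · refine mul_ne_zero (inv_ne_zero ?_) (mul_ne_zero hc ?_) <;>
        exact Nat.cast_ne_zero.2 (by omega)
    rw [phiUpIter, LinearMap.comp_apply, phiUp_apply, mul_assoc, mul_assoc]
    congr 1
    simp_rw [hf, ← mul_ite_zero, ← Finset.mul_sum]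
    rw [sum_ite_sum_ite (fun U : {U : Finset E // U.card = a + j} => U.val ⊆ T.val)
      (fun U (S : {S : Finset E // S.card = a}) => S.val ⊆ U.val)]
    congr 1
    rw [Finset.mul_sum]
    refine Finset.sum_congr rfl fun S _ => ?_
    simp_rw [and_comm (a := _ ⊆ T.val)]
    split_ifs with hST
    · rw [card_filter_subset_subset hST (by rw [S.2]; omega), T.2, S.2,
        show a + (j + 1) - a = j + 1 by omega, show a + j - a = j by omega,
        Nat.choose_succ_self_right]
    · rw [Finset.filter_false_of_mem fun U _ hU => hST (hU.1.trans hU.2)]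
      simp

/-- If `2 * i ≤ |E|`, then the disjointness matrix of `i`-element sets is injective. -/
theorem eq_zero_of_sum_disjoint_eq_zero {F : Type*} [Field F] [CharZero F] {E : Type*}
    [Fintype E] [DecidableEq E] {i : ℕ} (hi : 2 * i ≤ Fintype.card E)
    (f : {S : Finset E // S.card = i} → F)
    (h : ∀ J : {J : Finset E // J.card = i}, ∑ S, (if J.val ⊆ S.valᶜ then f S else 0) = 0) :
    f = 0 := by
  have small (J : Finset E) (hJ : J.card ≤ i) :
      ∑ S, (if J ⊆ S.valᶜ then f S else 0) = 0 := by
    have e : ∑ K : {K : Finset E // K.card = i}, (if J ⊆ K.val then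
        ∑ S, (if K.val ⊆ S.valᶜ then f S else 0) else 0) =
        ((Fintype.card E - i - J.card).choose (i - J.card) : F) *
          ∑ S, (if J ⊆ S.valᶜ then f S else 0) := by
      rw [sum_ite_sum_ite (fun K : {K : Finset E // K.card = i} => J ⊆ K.val)
        (fun K (S : {S : Finset E // S.card = i}) => K.val ⊆ S.valᶜ), Finset.mul_sum]
      refine Finset.sum_congr rfl fun S _ => ?_
      split_ifs with hJS
      · rw [card_filter_subset_subset hJS hJ, Finset.card_compl, S.2]
      · rw [Finset.filter_false_of_mem fun K _ hK => hJS (hK.1.trans hK.2)]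
        simp
    simp only [h, ite_self, Finset.sum_const_zero] at e
    refine (mul_eq_zero.1 e.symm).resolve_left ?_
    exact Nat.cast_ne_zero.2 (Nat.choose_pos (by omega)).ne'
  funext T
  have e : ∑ J ∈ T.val.powerset, (-1 : F) ^ J.card *
      ∑ S, (if J ⊆ S.valᶜ then f S else 0) = f T := by
    simp_rw [Finset.mul_sum, mul_ite_zero]
    rw [Finset.sum_comm]
    have inner (S : {S : Finset E // S.card = i}) :
        ∑ J ∈ T.val.powerset, (if J ⊆ S.valᶜ then (-1 : F) ^ J.card * f S else 0) =
          if S = T then f S else 0 := by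
      have hp : T.val.powerset.filter (· ⊆ S.valᶜ) = (T.val \ S.val).powerset := by
        ext J
        simp [Finset.subset_sdiff, Finset.subset_compl_iff_disjoint_right]
      have hz := congrArg (Int.cast : ℤ → F)
        (Finset.sum_powerset_neg_one_pow_card (x := T.val \ S.val))
      push_cast at hz
      have hST : T.val \ S.val = ∅ ↔ S = T := by
        rw [Finset.sdiff_eq_empty_iff_subset]
        refine ⟨fun hTS => ?_, fun hS => hS ▸ subset_rfl⟩
        exact Subtype.ext (Finset.eq_of_subset_of_card_le hTS (by rw [S.2, T.2])).symm
      rw [← Finset.sum_filter, hp, ← Finset.sum_mul, hz, ite_mul, one_mul, zero_mul]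
      simp only [hST]
    simp_rw [inner]
    simp
  rw [← e]
  refine Finset.sum_eq_zero fun J hJ => ?_
  rw [small J (T.2 ▸ Finset.card_le_card (Finset.mem_powerset.1 hJ)), mul_zero]


/-- For `|E| = n ≥ 1` and `0 ≤ i ≤ ⌊n/2⌋`, the composition
`φ_{n-i-1} ∘ ⋯ ∘ φ_{i+1} ∘ φ_i : V_{E,i} → V_{E,n-i}` (here `n - i = i + (n - 2i)`) is an
invertible (bijective) linear map. -/
theorem phiUpIter_bijective (F : Type) [Field F] [CharZero F]
    (E : Type) [Fintype E] [DecidableEq E] (hn : 1 ≤ Fintype.card E)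
    (i : ℕ) (hi : i ≤ Fintype.card E / 2) :
    Function.Bijective (phiUpIter F E i (Fintype.card E - 2 * i)) := by
  obtain ⟨c, hc, hf⟩ := exists_phiUpIter_apply (F := F) (E := E) i (Fintype.card E - 2 * i)
    (by omega)
  have hinj : Function.Injective (phiUpIter F E i (Fintype.card E - 2 * i)) := by
    rw [injective_iff_map_eq_zero]
    intro f hf0
    refine DFunLike.coe_injective (eq_zero_of_sum_disjoint_eq_zero (by omega) f fun J => ?_)
    have hJ := hf f ⟨J.valᶜ, by rw [Finset.card_compl, J.2]; omega⟩
    rw [hf0, Finsupp.zero_apply, eq_comm, mul_eq_zero] at hJ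
    simpa only [Finset.subset_compl_comm] using hJ.resolve_left hc
  refine ⟨hinj, (LinearMap.injective_iff_surjective_of_finrank_eq_finrank ?_).1 hinj⟩
  rw [Module.finrank_finsupp_self, Module.finrank_finsupp_self, Fintype.card_finset_len,
    Fintype.card_finset_len]
  exact Nat.choose_symm_of_eq_add (by omega)
end

section
/- For every finite set E of size n and all integers 0 ≤ b with b < ⌈n/2⌉, there exists an injection from the collection of b-element subsets of E into the collection of (b+1)-element subsets of E such that every b-element subset is mapped to a (b+1)-element superset of itself. -/
open Finset in
/-- A finite bipartite graph in which every vertex on the left has at least `m > 0` neighbours and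
every vertex on the right has at most `m` neighbours has a matching saturating the left side. -/
theorem exists_injective_of_le_card_of_card_filter_le {ι α : Type*} [DecidableEq α]
    (t : ι → Finset α) {m : ℕ} (hm : 0 < m) (ht : ∀ i, m ≤ #(t i))
    (hs : ∀ (s : Finset ι) (a : α), #{i ∈ s | a ∈ t i} ≤ m) :
    ∃ f : ι → α, Function.Injective f ∧ ∀ i, f i ∈ t i := by
  refine (all_card_le_biUnion_card_iff_exists_injective t).1 fun s => ?_
  refine Nat.le_of_mul_le_mul_right ?_ hm
  refine card_mul_le_card_mul (fun i a => a ∈ t i) (fun i hi => ?_) fun a _ => hs s a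
  refine (ht i).trans (card_le_card fun a ha => ?_)
  exact mem_filter.2 ⟨mem_biUnion.2 ⟨i, hi, ha⟩, ha⟩

/-- For every finite set `E` with `n` elements and every `0 ≤ b < ⌈n/2⌉`, there is an
injection from the `b`-element subsets of `E` into the `(b+1)`-element subsets of `E`
mapping every `b`-element subset to a superset of itself. -/
theorem exists_injection_to_supersets
    (E : Type) [Fintype E] [DecidableEq E]
    (b : ℕ) (hb : b < (Fintype.card E + 1) / 2) :
    ∃ f : {S : Finset E // S.card = b} → {T : Finset E // T.card = b + 1},
      Function.Injective f ∧ ∀ S, S.val ⊆ (f S).val := by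
  obtain ⟨f, hf, hft⟩ := exists_injective_of_le_card_of_card_filter_le
    (fun S : {S : Finset E // S.card = b} => S.valᶜ.image (insert · S.val)) b.succ_pos
    (fun S => by
      rw [Finset.card_image_of_injOn, Finset.card_compl, S.2]
      · omega
      · intro x hx y hy hxy
        exact (Finset.insert_inj (by simpa using hx)).1 hxy)
    (fun s T => by
      obtain h | ⟨S₀, hS₀⟩ := Finset.eq_empty_or_nonempty
        {S ∈ s | T ∈ S.valᶜ.image (insert · S.val)}
      · rw [h]; exact Nat.zero_le _
      have hT : T.card = b + 1 := by
        simp only [Finset.mem_filter, Finset.mem_image, Finset.mem_compl] at hS₀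
        obtain ⟨-, x, hx, rfl⟩ := hS₀
        rw [Finset.card_insert_of_notMem hx, S₀.2]
      calc _ ≤ (T.powersetCard b).card := by
            refine Finset.card_le_card_of_injOn Subtype.val (fun S hS => ?_)
              Subtype.val_injective.injOn
            simp only [Finset.coe_filter, Set.mem_ofPred_eq, Finset.mem_image] at hS
            obtain ⟨-, x, -, rfl⟩ := hS
            exact Finset.mem_coe.2
              (Finset.mem_powersetCard.2 ⟨Finset.subset_insert x S.val, S.2⟩)
        _ = b + 1 := by rw [Finset.card_powersetCard, hT, Nat.choose_succ_self_right])
  simp only [Finset.mem_image, Finset.mem_compl] at hft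
  refine ⟨fun S => ⟨f S, ?_⟩, fun S S' h => hf (congrArg Subtype.val h), fun S => ?_⟩
  · obtain ⟨x, hx, h⟩ := hft S
    rw [← h, Finset.card_insert_of_notMem hx, S.2]
  · obtain ⟨x, -, h⟩ := hft S
    exact (Finset.subset_insert x S.val).trans h.subset
end
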